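/- arXiv:math/0601007 — 4 statements merged into one kernel-verified Lean document; each statement's English description precedes it below -/
import Mathlib

section
/- Let F be the centered Gaussian process with covariance E[F(s)F(t)] = (2π)^{-1/2}(√(t+s) − √|t−s|), let {h_j} and L satisfy the deterministic form of Assumption 3.1, and let B_n(t) = ∑_{j=1}^{⌊nt⌋} σ_j² h_j(σ_j^{-1} ΔF_j). Fix 0 ≤ s < t and a constant κ ≥ 0. If lim_{n→∞} E|B_n(t) − B_n(s)|² = κ²(t − s), then the law of B_n(t) − B_n(s) converges weakly, as n → ∞, to the centered Gaussian law on ℝ with variance κ²(t − s). -/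
open MeasureTheory ProbabilityTheory Filter

/-- The covariance function `K(s,t) = (2π)^{-1/2}(√(t+s) − √|t−s|)`. -/
noncomputable def covK (s t : ℝ) : ℝ :=
  (Real.sqrt (2 * Real.pi))⁻¹ * (Real.sqrt (t + s) - Real.sqrt |t - s|)

/-- `F` is the centered Gaussian process with covariance `covK`, on a probability
space `(Ω, P)`: every finite linear combination of values of `F` at nonnegative
times is centered Gaussian with the prescribed variance. -/
def IsHeatGaussian {Ω : Type*} [MeasurableSpace Ω] (P : Measure Ω)
    (F : ℝ → Ω → ℝ) : Prop :=
  IsProbabilityMeasure P ∧ (∀ t : ℝ, Measurable (F t)) ∧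
  ∀ (m : ℕ) (ts : Fin m → ℝ) (c : Fin m → ℝ), (∀ i, 0 ≤ ts i) →
    Measure.map (fun ω => ∑ i, c i * F (ts i) ω) P =
      gaussianReal 0 (Real.toNNReal (∑ i, ∑ j, c i * c j * covK (ts i) (ts j)))

/-- A measure on `ℝ × ℝ` is a centered jointly Gaussian pair if every linear
combination of the coordinates has a centered Gaussian law. -/
def JointlyGaussianPair (μ : Measure (ℝ × ℝ)) : Prop :=
  ∀ a b : ℝ, ∃ v : NNReal,
    Measure.map (fun p => a * p.1 + b * p.2) μ = gaussianReal 0 v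

/-- The deterministic form of Assumption 3.1: each `h j` is `C¹`, with
`h_j(0)² ≤ L`, `h_j'(0)² ≤ L`, `h_j'` Lipschitz with constant `L_j`, `L_j² ≤ L`;
`E[h_j(X)] = 0` for a standard Gaussian `X`; and `|E[h_i(X)h_j(Y)]| ≤ L|ρ|` for
`i ≠ j` whenever `(X,Y)` is centered jointly Gaussian with unit variances and
covariance `ρ`. -/
def Assumption31 {ι : Type*} (h : ι → ℝ → ℝ) (L : ℝ) : Prop :=
  (∀ j, ContDiff ℝ 1 (h j)) ∧
  (∀ j, (h j 0) ^ 2 ≤ L) ∧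
  (∀ j, (deriv (h j) 0) ^ 2 ≤ L) ∧
  (∀ j, ∃ Lj : ℝ, Lj ^ 2 ≤ L ∧
    ∀ x y : ℝ, |deriv (h j) x - deriv (h j) y| ≤ Lj * |x - y|) ∧
  (∀ j, ∫ x, h j x ∂(gaussianReal 0 1) = 0) ∧
  (∀ i j, i ≠ j → ∀ μ : Measure (ℝ × ℝ), IsProbabilityMeasure μ →
    JointlyGaussianPair μ → (∫ p, p.1 ^ 2 ∂μ) = 1 → (∫ p, p.2 ^ 2 ∂μ) = 1 →
    |∫ p, h i p.1 * h j p.2 ∂μ| ≤ L * |∫ p, p.1 * p.2 ∂μ|)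

/-- `B_n(t) = ∑_{j=1}^{⌊nt⌋} σ_j² h_j(σ_j^{-1} ΔF_j)`, where
`ΔF_j = F(j/n) − F((j−1)/n)` and `σ_j² = E[ΔF_j²]`. -/
noncomputable def Bproc {Ω : Type*} [MeasurableSpace Ω] (P : Measure Ω)
    (F : ℝ → Ω → ℝ) (h : ℕ → ℝ → ℝ) (n : ℕ) (t : ℝ) (ω : Ω) : ℝ :=
  ∑ j ∈ Finset.Icc 1 ⌊(n : ℝ) * t⌋₊,
    (∫ ω', (F ((j : ℝ) / n) ω' - F (((j : ℝ) - 1) / n) ω') ^ 2 ∂P) *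
      h j ((Real.sqrt
          (∫ ω', (F ((j : ℝ) / n) ω' - F (((j : ℝ) - 1) / n) ω') ^ 2 ∂P))⁻¹ *
        (F ((j : ℝ) / n) ω - F (((j : ℝ) - 1) / n) ω))

/-! ### An `L¹` Poincaré inequality for centered Gaussian measures -/

section Poincare

open scoped ENNReal

/-- If `μ` is a probability measure such that `μ ⊗ μ` is rotation invariant and `T` is
differentiable along curves with continuous directional derivative `T'`, then the `L¹` norm of
`T y - T x` is at most `π / 2` times that of `T' x y`. -/
lemma lintegral_enorm_sub_le_of_map_rotation_eq_self {E : Type*} [NormedAddCommGroup E]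
    [NormedSpace ℝ E] [SecondCountableTopology E] [MeasurableSpace E] [BorelSpace E]
    {μ : Measure E} [IsProbabilityMeasure μ]
    (hrot : ∀ θ : ℝ, Measure.map (ContinuousLinearMap.rotation θ) (μ.prod μ) = μ.prod μ)
    {T : E → ℝ} {T' : E → E → ℝ} (hT' : Continuous (fun p : E × E => T' p.1 p.2))
    (hT : ∀ (γ : ℝ → E) (γ' : E) (θ : ℝ), HasDerivAt γ γ' θ →
      HasDerivAt (fun u => T (γ u)) (T' (γ θ) γ') θ) :
    ∫⁻ p, ‖T p.2 - T p.1‖ₑ ∂(μ.prod μ) ≤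
      ENNReal.ofReal (Real.pi / 2) * ∫⁻ p, ‖T' p.1 p.2‖ₑ ∂(μ.prod μ) := by
  have hpi : (0 : ℝ) ≤ Real.pi / 2 := by positivity
  let G : E × E → ℝ → ℝ := fun p θ =>
    T' (ContinuousLinearMap.rotation θ p).1 (ContinuousLinearMap.rotation θ p).2
  have hGc : Continuous (Function.uncurry G) := by
    have : Continuous (fun q : (E × E) × ℝ => ContinuousLinearMap.rotation q.2 q.1) := by
      simp only [ContinuousLinearMap.rotation_apply]
      fun_prop
    exact hT'.comp this
  have hpt : ∀ p : E × E,
      ‖T p.2 - T p.1‖ₑ ≤ ∫⁻ θ in Set.Ioc 0 (Real.pi / 2), ‖G p θ‖ₑ := by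
    intro p
    have hc : Continuous (G p) := hGc.uncurry_left p
    have hγ : ∀ θ : ℝ, HasDerivAt (fun u : ℝ => Real.cos u • p.1 + Real.sin u • p.2)
        (-Real.sin θ • p.1 + Real.cos θ • p.2) θ := fun θ =>
      ((Real.hasDerivAt_cos θ).smul_const p.1).add ((Real.hasDerivAt_sin θ).smul_const p.2)
    have hd : ∀ θ : ℝ,
        HasDerivAt (fun u : ℝ => T (Real.cos u • p.1 + Real.sin u • p.2)) (G p θ) θ :=
      fun θ => hT _ _ θ (hγ θ)
    have hint := intervalIntegral.integral_eq_sub_of_hasDerivAt (a := 0) (b := Real.pi / 2)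
      (fun θ _ => hd θ) (hc.intervalIntegrable _ _)
    simp only [Real.cos_pi_div_two, Real.sin_pi_div_two, Real.cos_zero, Real.sin_zero, zero_smul,
      one_smul, zero_add, add_zero] at hint
    rw [← hint, intervalIntegral.integral_of_le hpi]
    exact enorm_integral_le_lintegral_enorm _
  have hrotint : ∀ θ : ℝ, ∫⁻ p, ‖G p θ‖ₑ ∂(μ.prod μ) = ∫⁻ p, ‖T' p.1 p.2‖ₑ ∂(μ.prod μ) := by
    intro θ
    conv_rhs => rw [← hrot θ]
    rw [lintegral_map hT'.measurable.enorm (by fun_prop)]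
  calc ∫⁻ p, ‖T p.2 - T p.1‖ₑ ∂(μ.prod μ)
      ≤ ∫⁻ p, (∫⁻ θ in Set.Ioc 0 (Real.pi / 2), ‖G p θ‖ₑ) ∂(μ.prod μ) := lintegral_mono hpt
    _ = ∫⁻ θ in Set.Ioc 0 (Real.pi / 2), ∫⁻ p, ‖G p θ‖ₑ ∂(μ.prod μ) :=
        lintegral_lintegral_swap hGc.measurable.enorm.aemeasurable
    _ = ENNReal.ofReal (Real.pi / 2) * ∫⁻ p, ‖T' p.1 p.2‖ₑ ∂(μ.prod μ) := by
        simp_rw [hrotint]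
        rw [lintegral_const, Measure.restrict_apply_univ, Real.volume_Ioc, sub_zero, mul_comm]

/-- The `L¹` norm is at most the `L²` norm. -/
lemma integral_abs_le_sqrt_integral_sq {α : Type*} [MeasurableSpace α] {μ : Measure α}
    [IsProbabilityMeasure μ] {f : α → ℝ} (hf : MemLp f 2 μ) :
    ∫ x, |f x| ∂μ ≤ √(∫ x, f x ^ 2 ∂μ) := by
  apply Real.le_sqrt_of_sq_le
  have h := variance_nonneg (fun x => |f x|) μ
  rw [variance_eq_sub (X := fun x => |f x|) hf.abs] at h
  simpa [sq_abs] using h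

/-- `L¹` Poincaré inequality with real integrals. -/
lemma integral_abs_sub_integral_le_of_map_rotation_eq_self {E : Type*} [NormedAddCommGroup E]
    [NormedSpace ℝ E] [SecondCountableTopology E] [MeasurableSpace E] [BorelSpace E]
    {μ : Measure E} [IsProbabilityMeasure μ]
    (hrot : ∀ θ : ℝ, Measure.map (ContinuousLinearMap.rotation θ) (μ.prod μ) = μ.prod μ)
    {T : E → ℝ} {T' : E → E → ℝ} (hT' : Continuous (fun p : E × E => T' p.1 p.2))
    (hT : ∀ (γ : ℝ → E) (γ' : E) (θ : ℝ), HasDerivAt γ γ' θ →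
      HasDerivAt (fun u => T (γ u)) (T' (γ θ) γ') θ)
    (hTi : Integrable T μ) (hT'i : MemLp (fun p : E × E => T' p.1 p.2) 2 (μ.prod μ)) :
    ∫ x, |T x - ∫ y, T y ∂μ| ∂μ ≤
      Real.pi / 2 * √(∫ p, T' p.1 p.2 ^ 2 ∂(μ.prod μ)) := by
  have hdiff : Integrable (fun p : E × E => T p.2 - T p.1) (μ.prod μ) :=
    (hTi.comp_snd μ).sub (hTi.comp_fst μ)
  have h1 : ∫ x, |T x - ∫ y, T y ∂μ| ∂μ ≤ ∫ p, |T p.2 - T p.1| ∂(μ.prod μ) := by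
    rw [integral_prod _ hdiff.abs]
    refine integral_mono (hTi.sub (integrable_const _)).abs hdiff.abs.integral_prod_left ?_
    intro x
    have : T x - ∫ y, T y ∂μ = -∫ y, (T y - T x) ∂μ := by
      rw [integral_sub hTi (integrable_const _)]
      simp
    simp only [this, abs_neg]
    exact abs_integral_le_integral_abs
  have h2 : ∫ p, |T p.2 - T p.1| ∂(μ.prod μ) ≤
      Real.pi / 2 * ∫ p, |T' p.1 p.2| ∂(μ.prod μ) := by
    have hT'1 : Integrable (fun p : E × E => T' p.1 p.2) (μ.prod μ) :=
      hT'i.integrable (by norm_num)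
    have h := lintegral_enorm_sub_le_of_map_rotation_eq_self hrot hT' hT
    have e1 := integral_norm_eq_lintegral_enorm hdiff.aestronglyMeasurable
    have e2 := integral_norm_eq_lintegral_enorm hT'1.aestronglyMeasurable
    simp only [Real.norm_eq_abs] at e1 e2
    rw [e1, e2, ← ENNReal.toReal_ofReal (by positivity : (0 : ℝ) ≤ Real.pi / 2),
      ← ENNReal.toReal_mul]
    exact ENNReal.toReal_mono
      (ENNReal.mul_ne_top ENNReal.ofReal_ne_top hT'1.hasFiniteIntegral.ne) h
  refine h1.trans (h2.trans ?_)
  gcongr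
  exact integral_abs_le_sqrt_integral_sq hT'i

end Poincare

/-! ### Functions with moments of all orders -/

/-- `f` has finite moments of all orders under `μ`. -/
def HasAllMoments {α : Type*} [MeasurableSpace α] (f : α → ℝ) (μ : Measure α) : Prop :=
  ∀ p : ENNReal, p ≠ ⊤ → MemLp f p μ

namespace HasAllMoments

variable {α : Type*} [MeasurableSpace α] {μ : Measure α} {f g : α → ℝ}

lemma integrable (hf : HasAllMoments f μ) : Integrable f μ :=
  memLp_one_iff_integrable.1 (hf 1 (by simp))

lemma const [IsFiniteMeasure μ] (c : ℝ) : HasAllMoments (fun _ => c) μ :=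
  fun _ _ => memLp_const c

lemma add (hf : HasAllMoments f μ) (hg : HasAllMoments g μ) :
    HasAllMoments (fun x => f x + g x) μ :=
  fun p hp => (hf p hp).add (hg p hp)

lemma sub (hf : HasAllMoments f μ) (hg : HasAllMoments g μ) :
    HasAllMoments (fun x => f x - g x) μ :=
  fun p hp => (hf p hp).sub (hg p hp)

lemma mul (hf : HasAllMoments f μ) (hg : HasAllMoments g μ) :
    HasAllMoments (fun x => f x * g x) μ := by
  intro p hp
  have hp2 : 2 * p ≠ ⊤ := ENNReal.mul_ne_top (by simp) hp
  have : ENNReal.HolderTriple (2 * p) (2 * p) p := ⟨by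
    rw [ENNReal.mul_inv (by simp) (by simp), ← add_mul, ENNReal.inv_two_add_inv_two, one_mul]⟩
  exact (hg _ hp2).mul (hf _ hp2)

lemma const_mul (c : ℝ) (hf : HasAllMoments f μ) : HasAllMoments (fun x => c * f x) μ :=
  fun p hp => (hf p hp).const_mul c

lemma abs (hf : HasAllMoments f μ) : HasAllMoments (fun x => |f x|) μ :=
  fun p hp => (hf p hp).abs

lemma pow [IsFiniteMeasure μ] (hf : HasAllMoments f μ) (k : ℕ) :
    HasAllMoments (fun x => f x ^ k) μ := by
  induction k with
  | zero => simpa using const (μ := μ) 1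
  | succ k ih => simpa only [pow_succ] using ih.mul hf

lemma sum {ι : Type*} (s : Finset ι) {f : ι → α → ℝ} (hf : ∀ i ∈ s, HasAllMoments (f i) μ) :
    HasAllMoments (fun x => ∑ i ∈ s, f i x) μ :=
  fun p hp => memLp_finsetSum s fun i hi => hf i hi p hp

lemma mono (hg : HasAllMoments g μ) (hf : AEStronglyMeasurable f μ) (h : ∀ x, |f x| ≤ g x) :
    HasAllMoments f μ :=
  fun p hp => (hg p hp).mono' hf (Eventually.of_forall h)

end HasAllMoments

lemma norm_exp_ofReal_mul_I_sub_one_sub_le (x : ℝ) :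
    ‖Complex.exp (x * Complex.I) - 1 - x * Complex.I‖ ≤ 3 * x ^ 2 := by
  have hx : ‖(x : ℂ) * Complex.I‖ = |x| := by simp
  rcases le_total |x| 1 with h | h
  · have := Complex.norm_exp_sub_one_sub_id_le (x := x * Complex.I) (by rw [hx]; exact h)
    rw [hx, sq_abs] at this
    nlinarith [sq_nonneg x]
  · have h1 : ‖Complex.exp (x * Complex.I) - 1 - x * Complex.I‖ ≤ 1 + 1 + |x| := by
      refine (norm_sub_le _ _).trans (add_le_add ((norm_sub_le _ _).trans ?_) hx.le)
      rw [Complex.norm_exp_ofReal_mul_I, norm_one]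
    nlinarith [sq_abs x]

/-! ### `C^{1,1}` functions -/

/-- `g` is continuously differentiable with `Λ`-Lipschitz derivative, and with growth of `g` and
its derivative controlled by `Λ`. -/
structure QuadraticGrowth (g : ℝ → ℝ) (Λ : ℝ) : Prop where
  contDiff : ContDiff ℝ 1 g
  abs_le : ∀ x, |g x| ≤ Λ * (1 + |x|) ^ 2
  abs_deriv_le : ∀ x, |deriv g x| ≤ Λ * (1 + |x|)
  abs_deriv_sub_le : ∀ x y, |deriv g x - deriv g y| ≤ Λ * |x - y|

/-- A mean value inequality from a bound on the derivative that grows linearly. -/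
lemma abs_sub_le_of_abs_deriv_le {g : ℝ → ℝ} {Λ : ℝ} (hΛ : 0 ≤ Λ) (hg : Differentiable ℝ g)
    (h : ∀ x, |deriv g x| ≤ Λ * (1 + |x|)) {x y M : ℝ} (hx : |x| ≤ M) (hy : |y| ≤ M) :
    |g y - g x| ≤ Λ * (1 + M) * |y - x| := by
  refine (convex_Icc (-M) M).norm_image_sub_le_of_norm_deriv_le (f := g)
    (fun z _ => hg z) (fun z hz => (h z).trans ?_) (abs_le.1 hx) (abs_le.1 hy)
  gcongr
  exact abs_le.2 hz

lemma quadraticGrowth_of_lipschitz_deriv {g : ℝ → ℝ} {Λ : ℝ} (hΛ : 0 ≤ Λ)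
    (hg : ContDiff ℝ 1 g) (h0 : |g 0| ≤ Λ) (h1 : |deriv g 0| ≤ Λ)
    (hL : ∀ x y, |deriv g x - deriv g y| ≤ Λ * |x - y|) : QuadraticGrowth g Λ := by
  have hd : ∀ x, |deriv g x| ≤ Λ * (1 + |x|) := fun x => by
    have h2 := hL x 0
    have h3 := abs_sub_abs_le_abs_sub (deriv g x) (deriv g 0)
    rw [sub_zero] at h2
    linarith
  refine ⟨hg, fun x => ?_, hd, hL⟩
  have h2 := abs_sub_le_of_abs_deriv_le hΛ (hg.differentiable one_ne_zero) hd
    (x := 0) (y := x) (M := |x|) (by simp) le_rfl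
  have h3 := abs_sub_abs_le_abs_sub (g x) (g 0)
  rw [sub_zero] at h2
  nlinarith [mul_nonneg hΛ (abs_nonneg x)]

namespace QuadraticGrowth

variable {g : ℝ → ℝ} {Λ : ℝ}

lemma continuous (hg : QuadraticGrowth g Λ) : Continuous g := hg.contDiff.continuous

lemma continuous_deriv (hg : QuadraticGrowth g Λ) : Continuous (deriv g) :=
  hg.contDiff.continuous_deriv le_rfl

lemma hasDerivAt (hg : QuadraticGrowth g Λ) (x : ℝ) : HasDerivAt g (deriv g x) x :=
  (hg.contDiff.differentiable one_ne_zero x).hasDerivAt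

lemma nonneg (hg : QuadraticGrowth g Λ) : 0 ≤ Λ := by
  have := (abs_nonneg _).trans (hg.abs_deriv_le 0)
  simpa using this

lemma hasAllMoments_comp {α : Type*} [MeasurableSpace α] {μ : Measure α} [IsFiniteMeasure μ]
    (hg : QuadraticGrowth g Λ) {X : α → ℝ} (hX : HasAllMoments X μ) :
    HasAllMoments (fun x => g (X x)) μ :=
  HasAllMoments.mono ((((HasAllMoments.const 1).add hX.abs).pow 2).const_mul Λ)
    (hg.continuous.comp_aestronglyMeasurable (hX 0 (by simp)).1) fun x => hg.abs_le (X x)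

lemma abs_sub_shift_le (hg : QuadraticGrowth g Λ) {r : ℝ} (hr : |r| ≤ 1) (x y : ℝ) :
    |g y - g (y - r * x)| ≤ Λ * |r| * (1 + |x| + |y|) ^ 2 := by
  have hrx : |r * x| ≤ |x| := by
    rw [abs_mul]
    exact mul_le_of_le_one_left (abs_nonneg x) hr
  have h := abs_sub_le_of_abs_deriv_le hg.nonneg (hg.contDiff.differentiable one_ne_zero)
    hg.abs_deriv_le (x := y - r * x) (y := y) (M := |x| + |y|)
    ((abs_sub _ _).trans (by linarith)) (by linarith [abs_nonneg x])
  rw [sub_sub_cancel, abs_mul, ← add_assoc] at h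
  refine h.trans ?_
  have hΛ := hg.nonneg
  have : Λ * (1 + |x| + |y|) * (|r| * |x|) = Λ * |r| * ((1 + |x| + |y|) * |x|) := by ring
  rw [this, sq]
  gcongr
  linarith [abs_nonneg y]

lemma abs_deriv_shift_le (hg : QuadraticGrowth g Λ) {r : ℝ} (hr : |r| ≤ 1) (x y : ℝ) :
    |deriv g (y - r * x)| ≤ Λ * (1 + |x| + |y|) := by
  have hrx : |r * x| ≤ |x| := by
    rw [abs_mul]
    exact mul_le_of_le_one_left (abs_nonneg x) hr
  have hΛ := hg.nonneg
  refine (hg.abs_deriv_le _).trans (mul_le_mul_of_nonneg_left ?_ hΛ)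
  linarith [abs_sub y (r * x)]

lemma abs_deriv_sub_shift_le (hg : QuadraticGrowth g Λ) (r x y : ℝ) :
    |deriv g y - deriv g (y - r * x)| ≤ Λ * |r| * (1 + |x| + |y|) := by
  refine (hg.abs_deriv_sub_le _ _).trans ?_
  have hΛ := hg.nonneg
  rw [sub_sub_cancel, abs_mul, ← mul_assoc]
  gcongr
  linarith [abs_nonneg y]

end QuadraticGrowth

/-! ### Standardized Gaussian vectors -/

lemma strongDual_pi_apply {ι : Type*} [Fintype ι] [DecidableEq ι] (l : StrongDual ℝ (ι → ℝ))
    (x : ι → ℝ) : l x = ∑ i, l (Pi.single i 1) * x i := by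
  conv_lhs => rw [pi_eq_sum_univ' x]
  rw [map_sum]
  refine Finset.sum_congr rfl fun i _ => ?_
  rw [map_smul, smul_eq_mul, mul_comm]

/-- `μ` is a centered Gaussian measure with unit variances, correlations `ρ` with row sums at most
`R`, and `6`-th moments bounded by `K`. -/
structure StdGaussianVector {ι : Type*} [Fintype ι] (μ : Measure (ι → ℝ)) (ρ : ι → ι → ℝ)
    (R K : ℝ) : Prop where
  isGaussian : IsGaussian μ
  integral_eval : ∀ i, ∫ x, x i ∂μ = 0
  integral_mul : ∀ i j, ∫ x, x i * x j ∂μ = ρ i j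
  diag : ∀ i, ρ i i = 1
  row_sum : ∀ i, ∑ j, |ρ i j| ≤ R
  moment : ∀ i, ∫ x, (1 + |x i|) ^ 6 ∂μ ≤ K

namespace StdGaussianVector

variable {ι : Type*} [Fintype ι] {μ : Measure (ι → ℝ)} {ρ : ι → ι → ℝ} {R K : ℝ}

lemma hasAllMoments_eval (H : StdGaussianVector μ ρ R K) (i : ι) :
    HasAllMoments (fun x => x i) μ := fun p hp =>
  have := H.isGaussian
  IsGaussian.memLp_dual μ (ContinuousLinearMap.proj (R := ℝ) (φ := fun _ : ι => ℝ) i) p hp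

lemma symm (H : StdGaussianVector μ ρ R K) (i j : ι) : ρ i j = ρ j i := by
  rw [← H.integral_mul, ← H.integral_mul]
  simp_rw [mul_comm]

lemma abs_corr_le_one (H : StdGaussianVector μ ρ R K) (i j : ι) : |ρ i j| ≤ 1 := by
  have hi := H.hasAllMoments_eval i
  have hj := H.hasAllMoments_eval j
  have hii := H.integral_mul i i
  have hjj := H.integral_mul j j
  rw [H.diag] at hii hjj
  have h1 : ∫ x, (x i * x i + x j * x j) ∂μ = 2 := by
    rw [integral_add (hi.mul hi).integrable (hj.mul hj).integrable, hii, hjj]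
    norm_num
  have h2 : ∫ x, 2 * |x i * x j| ∂μ ≤ ∫ x, (x i * x i + x j * x j) ∂μ := by
    refine integral_mono ((hi.mul hj).abs.const_mul 2).integrable
      ((hi.mul hi).add (hj.mul hj)).integrable fun x => ?_
    simp only [abs_mul]
    nlinarith [sq_nonneg (|x i| - |x j|), sq_abs (x i), sq_abs (x j)]
  rw [integral_const_mul, h1] at h2
  have h3 := abs_integral_le_integral_abs (μ := μ) (f := fun x : ι → ℝ => x i * x j)
  rw [H.integral_mul] at h3
  linarith

lemma row_sum_nonneg (H : StdGaussianVector μ ρ R K) (i : ι) : 0 ≤ R :=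
  (Finset.sum_nonneg fun j _ => abs_nonneg (ρ i j)).trans (H.row_sum i)

lemma map_rotation_eq_self (H : StdGaussianVector μ ρ R K) (θ : ℝ) :
    Measure.map (ContinuousLinearMap.rotation θ) (μ.prod μ) = μ.prod μ := by
  have := H.isGaussian
  refine IsGaussian.map_rotation_eq_self_of_forall_strongDual_eq_zero (fun l => ?_) θ
  classical
  rw [integral_congr_ae (Eventually.of_forall (strongDual_pi_apply l))]
  rw [integral_finsetSum _ fun i _ => ((H.hasAllMoments_eval i).const_mul _).integrable]
  simp [integral_const_mul, H.integral_eval]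

/-- The weight controlling all functions of the pair `(x i, x j)`. -/
lemma hasAllMoments_weight (H : StdGaussianVector μ ρ R K) (i j : ι) :
    HasAllMoments (fun x => 1 + |x i| + |x j|) μ :=
  have := H.isGaussian
  ((HasAllMoments.const 1).add (H.hasAllMoments_eval i).abs).add (H.hasAllMoments_eval j).abs

lemma integral_weight_le (H : StdGaussianVector μ ρ R K) (i j : ι) :
    ∫ x, (1 + |x i| + |x j|) ^ 6 ∂μ ≤ 64 * K := by
  have := H.isGaussian
  have h6 : ∀ i, HasAllMoments (fun x : ι → ℝ => (1 + |x i|) ^ 6) μ := fun i =>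
    ((HasAllMoments.const 1).add (H.hasAllMoments_eval i).abs).pow 6
  calc ∫ x, (1 + |x i| + |x j|) ^ 6 ∂μ
      ≤ ∫ x, 32 * ((1 + |x i|) ^ 6 + (1 + |x j|) ^ 6) ∂μ := by
        refine integral_mono ((H.hasAllMoments_weight i j).pow 6).integrable
          (((h6 i).add (h6 j)).const_mul 32).integrable fun x => ?_
        have h := add_pow_le (a := 1 + |x i|) (b := 1 + |x j|) (by positivity) (by positivity) 6
        norm_num at h
        refine le_trans ?_ h
        gcongr
        linarith
    _ ≤ 64 * K := by
        rw [integral_const_mul, integral_add (h6 i).integrable (h6 j).integrable]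
        linarith [H.moment i, H.moment j]

/-- The regression residuals `x j - ρ i j x i` are independent of `x i`. -/
lemma indepFun_residual (H : StdGaussianVector μ ρ R K) (i : ι) :
    IndepFun (fun x : ι → ℝ => x i) (fun x j => x j - ρ i j * x i) μ := by
  have := H.isGaussian
  let l : (ι → ℝ) →L[ℝ] (Unit → ℝ) × (ι → ℝ) :=
    (ContinuousLinearMap.pi fun _ => ContinuousLinearMap.proj i).prod
      (ContinuousLinearMap.pi fun j =>
        ContinuousLinearMap.proj j - ρ i j • ContinuousLinearMap.proj i)
  have hl : HasGaussianLaw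
      (fun x : ι → ℝ => (fun _ : Unit => x i, fun j => x j - ρ i j * x i)) μ :=
    (IsGaussian.hasGaussianLaw_id (μ := μ)).map l
  have hind := hl.indepFun_of_covariance_eval (X := fun _ (x : ι → ℝ) => x i)
    (Y := fun j (x : ι → ℝ) => x j - ρ i j * x i) fun _ j => by
      have hi := H.hasAllMoments_eval i
      have hj := H.hasAllMoments_eval j
      rw [covariance_eq_sub (hi 2 (by simp)) ((hj.sub (hi.const_mul (ρ i j))) 2 (by simp)),
        H.integral_eval, zero_mul, sub_zero]
      have : ∀ x : ι → ℝ, x i * (x j - ρ i j * x i) = x i * x j - ρ i j * (x i * x i) :=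
        fun x => by ring
      simp only [Pi.mul_apply, this]
      rw [integral_sub (hi.mul hj).integrable ((hi.mul hi).const_mul _).integrable,
        integral_const_mul, H.integral_mul, H.integral_mul, H.diag, mul_one, sub_self]
  exact hind.comp (measurable_pi_apply ()) measurable_id

/-- Second moment of a linear functional with independent random coefficients. -/
lemma integral_sq_sum_mul_le (H : StdGaussianVector μ ρ R K) {A : ι → (ι → ℝ) → ℝ}
    (hA : ∀ i, HasAllMoments (A i) μ) :
    ∫ p, (∑ i, A i p.1 * p.2 i) ^ 2 ∂(μ.prod μ) ≤ R * ∑ i, ∫ x, A i x ^ 2 ∂μ := by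
  have := H.isGaussian
  have hint : ∀ i j, Integrable
      (fun p : (ι → ℝ) × (ι → ℝ) => (A i p.1 * A j p.1) * (p.2 i * p.2 j)) (μ.prod μ) :=
    fun i j => ((hA i).mul (hA j)).integrable.mul_prod
      ((H.hasAllMoments_eval i).mul (H.hasAllMoments_eval j)).integrable
  have hexp : ∀ p : (ι → ℝ) × (ι → ℝ), (∑ i, A i p.1 * p.2 i) ^ 2 =
      ∑ i, ∑ j, (A i p.1 * A j p.1) * (p.2 i * p.2 j) := fun p => by
    rw [sq, Finset.sum_mul_sum]
    exact Finset.sum_congr rfl fun i _ => Finset.sum_congr rfl fun j _ => by ring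
  have hAA : ∀ i j, |∫ x, A i x * A j x ∂μ| ≤ ((∫ x, A i x ^ 2 ∂μ) + ∫ x, A j x ^ 2 ∂μ) / 2 := by
    intro i j
    refine abs_integral_le_integral_abs.trans ?_
    rw [← integral_add ((hA i).pow 2).integrable ((hA j).pow 2).integrable, ← integral_div]
    refine integral_mono ((hA i).mul (hA j)).abs.integrable
      ((((hA i).pow 2).add ((hA j).pow 2)).integrable.div_const 2) fun x => ?_
    simp only [abs_mul]
    nlinarith [sq_nonneg (|A i x| - |A j x|), sq_abs (A i x), sq_abs (A j x)]
  have hnn : ∀ i, 0 ≤ ∫ x, A i x ^ 2 ∂μ := fun i => integral_nonneg fun x => sq_nonneg _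
  simp_rw [hexp]
  rw [integral_finsetSum _ fun i _ => integrable_finsetSum _ fun j _ => hint i j]
  have hrow : ∀ i, ∑ j, |ρ i j| * (∫ x, A i x ^ 2 ∂μ) / 2 ≤ R * (∫ x, A i x ^ 2 ∂μ) / 2 := by
    intro i
    rw [← Finset.sum_div, ← Finset.sum_mul]
    have := mul_le_mul_of_nonneg_right (H.row_sum i) (hnn i)
    linarith
  calc ∑ i, ∫ p, ∑ j, (A i p.1 * A j p.1) * (p.2 i * p.2 j) ∂(μ.prod μ)
      = ∑ i, ∑ j, (∫ x, A i x * A j x ∂μ) * ρ i j := by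
        refine Finset.sum_congr rfl fun i _ => ?_
        rw [integral_finsetSum _ fun j _ => hint i j]
        refine Finset.sum_congr rfl fun j _ => ?_
        rw [integral_prod_mul (fun x => A i x * A j x) (fun x : ι → ℝ => x i * x j),
          H.integral_mul]
    _ ≤ ∑ i, ∑ j, (|ρ i j| * (∫ x, A i x ^ 2 ∂μ) / 2 + |ρ j i| * (∫ x, A j x ^ 2 ∂μ) / 2) := by
        refine Finset.sum_le_sum fun i _ => Finset.sum_le_sum fun j _ => ?_
        rw [H.symm j i]
        refine (le_abs_self _).trans ?_
        rw [abs_mul]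
        have := mul_le_mul_of_nonneg_right (hAA i j) (abs_nonneg (ρ i j))
        linarith
    _ ≤ R * ∑ i, ∫ x, A i x ^ 2 ∂μ := by
        simp_rw [Finset.sum_add_distrib]
        rw [Finset.sum_comm (f := fun i j => |ρ j i| * (∫ x, A j x ^ 2 ∂μ) / 2), Finset.mul_sum]
        have := Finset.sum_le_sum fun i (_ : i ∈ Finset.univ) => hrow i
        rw [← Finset.sum_div] at this
        linarith

end StdGaussianVector

/-! ### Weighted sums of functions of a standardized Gaussian vector -/

section PairPartial

variable {ι : Type*} {ρ : ι → ι → ℝ} {g : ι → ℝ → ℝ} {Λ : ℝ}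

/-- The derivative of `g i (x i) * (g j (x j) - g j (x j - ρ i j * x i))` in `x i`, up to the
explicit dependence of the first factor of the product on the second coordinate. -/
noncomputable def pairPartialLeft (ρ : ι → ι → ℝ) (g : ι → ℝ → ℝ) (i j : ι) (x : ι → ℝ) : ℝ :=
  deriv (g i) (x i) * (g j (x j) - g j (x j - ρ i j * x i)) +
    ρ i j * (g i (x i) * deriv (g j) (x j - ρ i j * x i))

/-- The derivative of `g i (x i) * (g j (x j) - g j (x j - ρ i j * x i))` in `x j`. -/
noncomputable def pairPartialRight (ρ : ι → ι → ℝ) (g : ι → ℝ → ℝ) (i j : ι) (x : ι → ℝ) : ℝ :=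
  g i (x i) * (deriv (g j) (x j) - deriv (g j) (x j - ρ i j * x i))

lemma abs_pairPartialLeft_le (hg : ∀ i, QuadraticGrowth (g i) Λ) {i j : ι} (hρ : |ρ i j| ≤ 1)
    (x : ι → ℝ) :
    |pairPartialLeft ρ g i j x| ≤ 2 * Λ ^ 2 * (|ρ i j| * (1 + |x i| + |x j|) ^ 3) := by
  have hΛ := (hg i).nonneg
  have hxj := abs_nonneg (x j)
  have hw : 1 + |x i| ≤ 1 + |x i| + |x j| := by linarith
  have h1 : |deriv (g i) (x i)| ≤ Λ * (1 + |x i| + |x j|) :=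
    ((hg i).abs_deriv_le _).trans (by gcongr)
  have h2 := (hg j).abs_sub_shift_le hρ (x i) (x j)
  have h3 : |g i (x i)| ≤ Λ * (1 + |x i| + |x j|) ^ 2 := ((hg i).abs_le _).trans (by gcongr)
  have h4 := (hg j).abs_deriv_shift_le hρ (x i) (x j)
  refine (abs_add_le _ _).trans ?_
  rw [abs_mul, abs_mul, abs_mul]
  calc _ ≤ Λ * (1 + |x i| + |x j|) * (Λ * |ρ i j| * (1 + |x i| + |x j|) ^ 2) +
        |ρ i j| * (Λ * (1 + |x i| + |x j|) ^ 2 * (Λ * (1 + |x i| + |x j|))) := by gcongr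
    _ = _ := by ring

lemma abs_pairPartialRight_le (hg : ∀ i, QuadraticGrowth (g i) Λ) (i j : ι) (x : ι → ℝ) :
    |pairPartialRight ρ g i j x| ≤ Λ ^ 2 * (|ρ i j| * (1 + |x i| + |x j|) ^ 3) := by
  have hΛ := (hg i).nonneg
  have hxj := abs_nonneg (x j)
  have h2 := (hg j).abs_deriv_sub_shift_le (ρ i j) (x i) (x j)
  have hw : 1 + |x i| ≤ 1 + |x i| + |x j| := by linarith
  have h3 : |g i (x i)| ≤ Λ * (1 + |x i| + |x j|) ^ 2 := ((hg i).abs_le _).trans (by gcongr)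
  rw [pairPartialRight, abs_mul]
  calc _ ≤ Λ * (1 + |x i| + |x j|) ^ 2 * (Λ * |ρ i j| * (1 + |x i| + |x j|)) := by gcongr
    _ = _ := by ring

end PairPartial

section WeightedSum

variable {ι : Type*} [Fintype ι]

/-- The weighted sum `∑ j, a j * g j (x j)`. -/
def weightedSum (a : ι → ℝ) (g : ι → ℝ → ℝ) (x : ι → ℝ) : ℝ :=
  ∑ j, a j * g j (x j)

/-- The change in `weightedSum` when every coordinate is replaced by its regression residual on
coordinate `i`. -/
def residualIncrement (ρ : ι → ι → ℝ) (a : ι → ℝ) (g : ι → ℝ → ℝ) (i : ι) (x : ι → ℝ) : ℝ :=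
  ∑ j, a j * (g j (x j) - g j (x j - ρ i j * x i))

/-- The Stein kernel associated with `weightedSum`. -/
def steinKernel (ρ : ι → ι → ℝ) (a : ι → ℝ) (g : ι → ℝ → ℝ) (x : ι → ℝ) : ℝ :=
  ∑ i, a i * g i (x i) * residualIncrement ρ a g i x

/-- The partial derivative of `steinKernel` in the coordinate `m`. -/
noncomputable def steinKernelPartial (ρ : ι → ι → ℝ) (a : ι → ℝ) (g : ι → ℝ → ℝ) (m : ι) (x : ι → ℝ) : ℝ :=
  ∑ j, a m * a j * (pairPartialLeft ρ g m j x + pairPartialRight ρ g j m x)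

variable {ρ : ι → ι → ℝ} {a : ι → ℝ} {g : ι → ℝ → ℝ} {Λ α : ℝ}

lemma continuous_weightedSum (hg : ∀ i, QuadraticGrowth (g i) Λ) :
    Continuous (weightedSum a g) := by
  have := fun i => (hg i).continuous
  unfold weightedSum
  fun_prop

lemma continuous_residualIncrement (hg : ∀ i, QuadraticGrowth (g i) Λ) (i : ι) :
    Continuous (residualIncrement ρ a g i) := by
  have := fun i => (hg i).continuous
  unfold residualIncrement
  fun_prop

lemma continuous_steinKernelPartial (hg : ∀ i, QuadraticGrowth (g i) Λ) (m : ι) :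
    Continuous (steinKernelPartial ρ a g m) := by
  have := fun i => (hg i).continuous
  have := fun i => (hg i).continuous_deriv
  unfold steinKernelPartial pairPartialLeft pairPartialRight
  fun_prop

lemma weightedSum_residual (i : ι) (x : ι → ℝ) :
    weightedSum a g (fun j => x j - ρ i j * x i) =
      weightedSum a g x - residualIncrement ρ a g i x := by
  simp only [weightedSum, residualIncrement, ← Finset.sum_sub_distrib]
  exact Finset.sum_congr rfl fun j _ => by ring

lemma hasDerivAt_steinKernel (hg : ∀ i, QuadraticGrowth (g i) Λ) (γ : ℝ → ι → ℝ) (γ' : ι → ℝ)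
    (θ : ℝ) (hγ : HasDerivAt γ γ' θ) :
    HasDerivAt (fun u => steinKernel ρ a g (γ u))
      (∑ m, steinKernelPartial ρ a g m (γ θ) * γ' m) θ := by
  have hγi := hasDerivAt_pi.1 hγ
  have hT : ∀ x, steinKernel ρ a g x =
      ∑ i, ∑ j, a i * a j * (g i (x i) * (g j (x j) - g j (x j - ρ i j * x i))) := fun x => by
    simp only [steinKernel, residualIncrement, Finset.mul_sum]
    exact Finset.sum_congr rfl fun i _ => Finset.sum_congr rfl fun j _ => by ring
  simp_rw [hT]
  have key : ∑ m, steinKernelPartial ρ a g m (γ θ) * γ' m =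
      ∑ i, ∑ j, a i * a j *
        (pairPartialLeft ρ g i j (γ θ) * γ' i + pairPartialRight ρ g i j (γ θ) * γ' j) := by
    simp only [steinKernelPartial, Finset.sum_mul, mul_add, add_mul, Finset.sum_add_distrib]
    congr 1
    · exact Finset.sum_congr rfl fun i _ => Finset.sum_congr rfl fun j _ => by ring
    · rw [Finset.sum_comm]
      exact Finset.sum_congr rfl fun i _ => Finset.sum_congr rfl fun j _ => by ring
  rw [key]
  refine HasDerivAt.fun_sum fun i _ => HasDerivAt.fun_sum fun j _ => HasDerivAt.const_mul _ ?_
  have h1 := ((hg i).hasDerivAt (γ θ i)).comp θ (hγi i)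
  have h2 := ((hg j).hasDerivAt (γ θ j)).comp θ (hγi j)
  have h3 := ((hg j).hasDerivAt (γ θ j - ρ i j * γ θ i)).comp θ
    ((hγi j).sub ((hγi i).const_mul (ρ i j)))
  refine (h1.mul (h2.sub h3)).congr_deriv ?_
  simp only [pairPartialLeft, pairPartialRight, Function.comp_apply, Pi.sub_apply]
  ring

lemma abs_residualIncrement_le (hg : ∀ i, QuadraticGrowth (g i) Λ) (ha : ∀ i, |a i| ≤ α)
    (hρ : ∀ i j, |ρ i j| ≤ 1) (i : ι) (x : ι → ℝ) :
    |residualIncrement ρ a g i x| ≤ α * Λ * ∑ j, |ρ i j| * (1 + |x i| + |x j|) ^ 2 := by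
  rw [Finset.mul_sum]
  refine (Finset.abs_sum_le_sum_abs _ _).trans (Finset.sum_le_sum fun j _ => ?_)
  rw [abs_mul]
  have h := (hg j).abs_sub_shift_le (hρ i j) (x i) (x j)
  have h0 := (abs_nonneg _).trans (ha j)
  refine (mul_le_mul (ha j) h (abs_nonneg _) h0).trans (le_of_eq ?_)
  ring

lemma abs_steinKernelPartial_le (hg : ∀ i, QuadraticGrowth (g i) Λ) (ha : ∀ i, |a i| ≤ α)
    (hρ : ∀ i j, |ρ i j| ≤ 1) (hsymm : ∀ i j, ρ i j = ρ j i) (m : ι) (x : ι → ℝ) :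
    |steinKernelPartial ρ a g m x| ≤
      3 * Λ ^ 2 * α ^ 2 * ∑ j, |ρ m j| * (1 + |x m| + |x j|) ^ 3 := by
  rw [Finset.mul_sum]
  refine (Finset.abs_sum_le_sum_abs _ _).trans (Finset.sum_le_sum fun j _ => ?_)
  have hα := (abs_nonneg _).trans (ha j)
  have h1 := abs_pairPartialLeft_le hg (hρ m j) x
  have h2 := abs_pairPartialRight_le (ρ := ρ) hg j m x
  rw [hsymm j m, add_right_comm] at h2
  have h3 : |pairPartialLeft ρ g m j x + pairPartialRight ρ g j m x| ≤
      3 * Λ ^ 2 * (|ρ m j| * (1 + |x m| + |x j|) ^ 3) := (abs_add_le _ _).trans (by linarith)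
  rw [abs_mul, abs_mul]
  calc _ ≤ α * α * (3 * Λ ^ 2 * (|ρ m j| * (1 + |x m| + |x j|) ^ 3)) := by
        gcongr
        · exact ha m
        · exact ha j
    _ = _ := by ring

end WeightedSum

/-! ### Stein's method for weighted sums -/

lemma integrable_ofReal_mul_exp {E : Type*} [MeasurableSpace E] {μ : Measure E} {f S : E → ℝ}
    (hf : Integrable f μ) (hS : AEStronglyMeasurable S μ) (u : ℝ) :
    Integrable (fun x => (f x : ℂ) * Complex.exp ((u * S x : ℝ) * Complex.I)) μ := by
  refine hf.ofReal.mul_bdd (c := 1) ?_ (Eventually.of_forall fun x => ?_)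
  · have : Continuous fun y : ℝ => Complex.exp ((u * y : ℝ) * Complex.I) := by fun_prop
    exact this.comp_aestronglyMeasurable hS
  · rw [Complex.norm_exp_ofReal_mul_I]

namespace StdGaussianVector

variable {ι : Type*} [Fintype ι] {μ : Measure (ι → ℝ)} {ρ : ι → ι → ℝ} {R K : ℝ}
  {g : ι → ℝ → ℝ} {a : ι → ℝ} {Λ α : ℝ}

lemma hasAllMoments_weightedSum (H : StdGaussianVector μ ρ R K)
    (hg : ∀ i, QuadraticGrowth (g i) Λ) : HasAllMoments (weightedSum a g) μ :=
  have := H.isGaussian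
  HasAllMoments.sum _ fun j _ =>
    ((hg j).hasAllMoments_comp (H.hasAllMoments_eval j)).const_mul (a j)

lemma hasAllMoments_residualIncrement (H : StdGaussianVector μ ρ R K)
    (hg : ∀ i, QuadraticGrowth (g i) Λ) (i : ι) :
    HasAllMoments (residualIncrement ρ a g i) μ :=
  have := H.isGaussian
  HasAllMoments.sum _ fun j _ =>
    (((hg j).hasAllMoments_comp (H.hasAllMoments_eval j)).sub
      ((hg j).hasAllMoments_comp
        ((H.hasAllMoments_eval j).sub ((H.hasAllMoments_eval i).const_mul _)))).const_mul (a j)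

lemma hasAllMoments_steinKernel (H : StdGaussianVector μ ρ R K)
    (hg : ∀ i, QuadraticGrowth (g i) Λ) : HasAllMoments (steinKernel ρ a g) μ :=
  have := H.isGaussian
  HasAllMoments.sum _ fun i _ =>
    (((hg i).hasAllMoments_comp (H.hasAllMoments_eval i)).const_mul (a i)).mul
      (H.hasAllMoments_residualIncrement hg i)

lemma hasAllMoments_sum_weight (H : StdGaussianVector μ ρ R K) (i : ι) (k : ℕ) :
    HasAllMoments (fun x => ∑ j, |ρ i j| * (1 + |x i| + |x j|) ^ k) μ :=
  have := H.isGaussian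
  HasAllMoments.sum _ fun j _ => ((H.hasAllMoments_weight i j).pow k).const_mul _

lemma integral_sum_weight_le (H : StdGaussianVector μ ρ R K) (i : ι) :
    ∫ x, ∑ j, |ρ i j| * (1 + |x i| + |x j|) ^ 6 ∂μ ≤ 64 * R * K := by
  have := H.isGaussian
  have hK : 0 ≤ 64 * K := (integral_nonneg fun x => by positivity).trans
    (H.integral_weight_le i i)
  rw [integral_finsetSum _ fun j _ => (((H.hasAllMoments_weight i j).pow 6).const_mul _).integrable]
  calc ∑ j, ∫ x, |ρ i j| * (1 + |x i| + |x j|) ^ 6 ∂μ ≤ ∑ j, |ρ i j| * (64 * K) := by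
        refine Finset.sum_le_sum fun j _ => ?_
        rw [integral_const_mul]
        exact mul_le_mul_of_nonneg_left (H.integral_weight_le i j) (abs_nonneg _)
    _ ≤ R * (64 * K) := by
        rw [← Finset.sum_mul]
        exact mul_le_mul_of_nonneg_right (H.row_sum i) hK
    _ = 64 * R * K := by ring

lemma sq_sum_abs_corr_mul_le (H : StdGaussianVector μ ρ R K) (i : ι) (f : ι → ℝ) :
    (∑ j, |ρ i j| * f j) ^ 2 ≤ R * ∑ j, |ρ i j| * f j ^ 2 := by
  refine (Finset.sum_sq_le_sum_mul_sum_of_sq_le_mul Finset.univ (f := fun j => |ρ i j|)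
    (g := fun j => |ρ i j| * f j ^ 2) (fun j _ => abs_nonneg _) (fun j _ => by positivity)
    fun j _ => le_of_eq (by ring)).trans ?_
  exact mul_le_mul_of_nonneg_right (H.row_sum i) (Finset.sum_nonneg fun j _ => by positivity)

lemma integral_abs_steinKernel_sub_le (H : StdGaussianVector μ ρ R K)
    (hg : ∀ i, QuadraticGrowth (g i) Λ) (ha : ∀ i, |a i| ≤ α) :
    ∫ x, |steinKernel ρ a g x - ∫ y, steinKernel ρ a g y ∂μ| ∂μ ≤
      Real.pi / 2 * √(R * (Fintype.card ι * (576 * Λ ^ 4 * α ^ 4 * R ^ 2 * K))) := by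
  have := H.isGaussian
  have hA : ∀ m, HasAllMoments (steinKernelPartial ρ a g m) μ := fun m =>
    ((H.hasAllMoments_sum_weight m 3).const_mul (3 * Λ ^ 2 * α ^ 2)).mono
      (continuous_steinKernelPartial hg m).aestronglyMeasurable
      (abs_steinKernelPartial_le hg ha H.abs_corr_le_one H.symm m)
  have hA2 : ∀ m, ∫ x, steinKernelPartial ρ a g m x ^ 2 ∂μ ≤
      576 * Λ ^ 4 * α ^ 4 * R ^ 2 * K := fun m => by
    have hR := H.row_sum_nonneg m
    calc ∫ x, steinKernelPartial ρ a g m x ^ 2 ∂μ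
        ≤ ∫ x, 9 * Λ ^ 4 * α ^ 4 * R * ∑ j, |ρ m j| * (1 + |x m| + |x j|) ^ 6 ∂μ := by
          refine integral_mono ((hA m).pow 2).integrable
            ((H.hasAllMoments_sum_weight m 6).const_mul _).integrable fun x => ?_
          have h1 := abs_steinKernelPartial_le hg ha H.abs_corr_le_one H.symm m x
          have h2 := H.sq_sum_abs_corr_mul_le m fun j => (1 + |x m| + |x j|) ^ 3
          simp only [← pow_mul] at h2
          norm_num at h2
          calc steinKernelPartial ρ a g m x ^ 2
              ≤ (3 * Λ ^ 2 * α ^ 2 * ∑ j, |ρ m j| * (1 + |x m| + |x j|) ^ 3) ^ 2 :=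
                sq_le_sq' (abs_le.1 h1).1 (abs_le.1 h1).2
            _ = 9 * Λ ^ 4 * α ^ 4 * (∑ j, |ρ m j| * (1 + |x m| + |x j|) ^ 3) ^ 2 := by ring
            _ ≤ 9 * Λ ^ 4 * α ^ 4 * (R * ∑ j, |ρ m j| * (1 + |x m| + |x j|) ^ 6) := by gcongr
            _ = _ := by ring
      _ ≤ 9 * Λ ^ 4 * α ^ 4 * R * (64 * R * K) := by
          rw [integral_const_mul]
          exact mul_le_mul_of_nonneg_left (H.integral_sum_weight_le m) (by positivity)
      _ = _ := by ring
  have hT' : HasAllMoments (fun p : (ι → ℝ) × (ι → ℝ) =>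
      ∑ m, steinKernelPartial ρ a g m p.1 * p.2 m) (μ.prod μ) :=
    HasAllMoments.sum _ fun m _ => HasAllMoments.mul
      (fun p hp => (hA m p hp).comp_measurePreserving measurePreserving_fst)
      (fun p hp => (H.hasAllMoments_eval m p hp).comp_measurePreserving measurePreserving_snd)
  have hcont := fun m => continuous_steinKernelPartial (ρ := ρ) (a := a) hg m
  refine (integral_abs_sub_integral_le_of_map_rotation_eq_self H.map_rotation_eq_self
    (T' := fun x y => ∑ m, steinKernelPartial ρ a g m x * y m) (by fun_prop)
    (hasDerivAt_steinKernel hg) (H.hasAllMoments_steinKernel hg).integrable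
    (hT' 2 (by simp))).trans ?_
  gcongr
  refine (H.integral_sq_sum_mul_le hA).trans ?_
  rcases isEmpty_or_nonempty ι with h | ⟨⟨m⟩⟩
  · simp
  · refine mul_le_mul_of_nonneg_left ?_ (H.row_sum_nonneg m)
    refine (Finset.sum_le_sum fun m _ => hA2 m).trans ?_
    simp

/-- Regression residuals decouple. -/
lemma integral_mul_residual_eq_zero (H : StdGaussianVector μ ρ R K)
    (hg : ∀ i, QuadraticGrowth (g i) Λ) (hmean : ∀ i, ∫ x, g i (x i) ∂μ = 0) (i : ι)
    {𝕜 : Type*} [RCLike 𝕜] {φ : ℝ → 𝕜} (hφ : Continuous φ) :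
    ∫ x, (g i (x i) : 𝕜) * φ (weightedSum a g x - residualIncrement ρ a g i x) ∂μ = 0 := by
  have hc : Continuous fun x : ι → ℝ => φ (weightedSum a g x) :=
    hφ.comp (continuous_weightedSum hg)
  have hgi : Continuous fun x : ℝ => (g i x : 𝕜) :=
    RCLike.continuous_ofReal.comp (hg i).continuous
  have hind := (H.indepFun_residual i).comp hgi.measurable hc.measurable
  have h := hind.integral_fun_mul_eq_mul_integral
    (hgi.comp (continuous_apply i)).aestronglyMeasurable
    (hc.comp (by fun_prop)).aestronglyMeasurable
  simp only [Function.comp_apply, weightedSum_residual] at h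
  rw [h, integral_ofReal, hmean]
  simp

lemma integral_steinKernel (H : StdGaussianVector μ ρ R K)
    (hg : ∀ i, QuadraticGrowth (g i) Λ) (hmean : ∀ i, ∫ x, g i (x i) ∂μ = 0) :
    ∫ x, steinKernel ρ a g x ∂μ = ∫ x, weightedSum a g x ^ 2 ∂μ := by
  have := H.isGaussian
  have hS := H.hasAllMoments_weightedSum (a := a) hg
  have hgi := fun i => (hg i).hasAllMoments_comp (H.hasAllMoments_eval i)
  have hD := H.hasAllMoments_residualIncrement (a := a) hg
  have h : ∀ x, weightedSum a g x ^ 2 = steinKernel ρ a g x +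
      ∑ i, a i * (g i (x i) * (weightedSum a g x - residualIncrement ρ a g i x)) := fun x => by
    rw [sq]
    nth_rw 1 [weightedSum]
    rw [steinKernel, Finset.sum_mul, ← Finset.sum_add_distrib]
    exact Finset.sum_congr rfl fun i _ => by ring
  have hi : ∀ i, Integrable (fun x => a i * (g i (x i) *
      (weightedSum a g x - residualIncrement ρ a g i x))) μ := fun i =>
    (((hgi i).mul (hS.sub (hD i))).const_mul (a i)).integrable
  simp_rw [h]
  rw [integral_add (H.hasAllMoments_steinKernel hg).integrable
    (integrable_finsetSum _ fun i _ => hi i), integral_finsetSum _ fun i _ => hi i]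
  have h0 : ∀ i, ∫ x, a i * (g i (x i) *
      (weightedSum a g x - residualIncrement ρ a g i x)) ∂μ = 0 := fun i => by
    rw [integral_const_mul]
    have := H.integral_mul_residual_eq_zero (a := a) hg hmean i (φ := fun y : ℝ => y) continuous_id
    simp only [RCLike.ofReal_real_eq_id, id] at this
    rw [this, mul_zero]
  simp [h0]

end StdGaussianVector

namespace StdGaussianVector

variable {ι : Type*} [Fintype ι] {μ : Measure (ι → ℝ)} {ρ : ι → ι → ℝ} {R K : ℝ}
  {g : ι → ℝ → ℝ} {a : ι → ℝ} {Λ α : ℝ}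

/-- Pointwise remainder in the Taylor expansion of `exp (i u S)` around the decoupled sums. -/
lemma norm_stein_remainder_le (H : StdGaussianVector μ ρ R K)
    (hg : ∀ i, QuadraticGrowth (g i) Λ) (ha : ∀ i, |a i| ≤ α) (u : ℝ) (i : ι) (x : ι → ℝ) :
    ‖(a i * g i (x i) : ℝ) * (Complex.exp ((u * weightedSum a g x : ℝ) * Complex.I) -
        Complex.exp ((u * (weightedSum a g x - residualIncrement ρ a g i x) : ℝ) * Complex.I) -
        (u * residualIncrement ρ a g i x : ℝ) * Complex.I *
          Complex.exp ((u * weightedSum a g x : ℝ) * Complex.I))‖ ≤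
      3 * u ^ 2 * α ^ 3 * Λ ^ 3 * R * ∑ j, |ρ i j| * (1 + |x i| + |x j|) ^ 6 := by
  set S := weightedSum a g x
  set D := residualIncrement ρ a g i x with hD
  have hα := (abs_nonneg _).trans (ha i)
  have hΛ := (hg i).nonneg
  have hR := H.row_sum_nonneg i
  have hexp : Complex.exp ((u * S : ℝ) * Complex.I) -
      Complex.exp ((u * (S - D) : ℝ) * Complex.I) -
        (u * D : ℝ) * Complex.I * Complex.exp ((u * S : ℝ) * Complex.I) =
      -(Complex.exp ((u * S : ℝ) * Complex.I) *
        (Complex.exp ((-(u * D) : ℝ) * Complex.I) - 1 - (-(u * D) : ℝ) * Complex.I)) := by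
    have : ((u * (S - D) : ℝ) : ℂ) * Complex.I =
        (u * S : ℝ) * Complex.I + (-(u * D) : ℝ) * Complex.I := by push_cast; ring
    rw [this, Complex.exp_add]
    push_cast
    ring
  have h1 := norm_exp_ofReal_mul_I_sub_one_sub_le (-(u * D))
  have hD2 : D ^ 2 ≤ α ^ 2 * Λ ^ 2 * (R * ∑ j, |ρ i j| * (1 + |x i| + |x j|) ^ 4) := by
    have h2 := abs_residualIncrement_le hg ha H.abs_corr_le_one i x
    have h3 := H.sq_sum_abs_corr_mul_le i fun j => (1 + |x i| + |x j|) ^ 2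
    simp only [← pow_mul] at h3
    norm_num at h3
    calc D ^ 2 ≤ (α * Λ * ∑ j, |ρ i j| * (1 + |x i| + |x j|) ^ 2) ^ 2 :=
          sq_le_sq' (abs_le.1 h2).1 (abs_le.1 h2).2
      _ = α ^ 2 * Λ ^ 2 * (∑ j, |ρ i j| * (1 + |x i| + |x j|) ^ 2) ^ 2 := by ring
      _ ≤ _ := by gcongr
  rw [hexp, norm_mul, norm_neg, norm_mul, Complex.norm_exp_ofReal_mul_I, one_mul,
    Complex.norm_real, Real.norm_eq_abs, abs_mul]
  calc |a i| * |g i (x i)| *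
        ‖Complex.exp ((-(u * D) : ℝ) * Complex.I) - 1 - (-(u * D) : ℝ) * Complex.I‖
      ≤ α * (Λ * (1 + |x i|) ^ 2) * (3 * (-(u * D)) ^ 2) := by
        gcongr
        · exact ha i
        · exact (hg i).abs_le _
    _ = 3 * u ^ 2 * α * (Λ * (1 + |x i|) ^ 2) * D ^ 2 := by ring
    _ ≤ 3 * u ^ 2 * α * (Λ * (1 + |x i|) ^ 2) *
        (α ^ 2 * Λ ^ 2 * (R * ∑ j, |ρ i j| * (1 + |x i| + |x j|) ^ 4)) := by gcongr
    _ = 3 * u ^ 2 * α ^ 3 * Λ ^ 3 * R *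
        ∑ j, |ρ i j| * ((1 + |x i|) ^ 2 * (1 + |x i| + |x j|) ^ 4) := by
        simp only [Finset.mul_sum]
        exact Finset.sum_congr rfl fun j _ => by ring
    _ ≤ _ := by
        gcongr with j
        have hw : 1 + |x i| ≤ 1 + |x i| + |x j| := by linarith [abs_nonneg (x j)]
        rw [show (6 : ℕ) = 2 + 4 from rfl, pow_add]
        gcongr

lemma norm_integral_weightedSum_sub_steinKernel_le (H : StdGaussianVector μ ρ R K)
    (hg : ∀ i, QuadraticGrowth (g i) Λ) (ha : ∀ i, |a i| ≤ α)
    (hmean : ∀ i, ∫ x, g i (x i) ∂μ = 0) (u : ℝ) :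
    ‖(∫ x, (weightedSum a g x : ℂ) *
          Complex.exp ((u * weightedSum a g x : ℝ) * Complex.I) ∂μ) -
        u * Complex.I * ∫ x, (steinKernel ρ a g x : ℂ) *
          Complex.exp ((u * weightedSum a g x : ℝ) * Complex.I) ∂μ‖ ≤
      192 * u ^ 2 * (Fintype.card ι * α ^ 3 * Λ ^ 3 * R ^ 2 * K) := by
  have := H.isGaussian
  have hSm : AEStronglyMeasurable (weightedSum a g) μ :=
    (continuous_weightedSum hg).aestronglyMeasurable
  have hS := integrable_ofReal_mul_exp (H.hasAllMoments_weightedSum (a := a) hg).integrable hSm u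
  have hT := (integrable_ofReal_mul_exp
    (H.hasAllMoments_steinKernel (a := a) hg).integrable hSm u).const_mul (u * Complex.I)
  have hr : ∀ i, Integrable (fun x => ((a i * g i (x i) : ℝ) : ℂ) * Complex.exp
      ((u * (weightedSum a g x - residualIncrement ρ a g i x) : ℝ) * Complex.I)) μ := fun i =>
    integrable_ofReal_mul_exp
      (((hg i).hasAllMoments_comp (H.hasAllMoments_eval i)).const_mul (a i)).integrable
      ((continuous_weightedSum hg).sub (continuous_residualIncrement hg i)).aestronglyMeasurable u
  have hr0 : ∀ i, ∫ x, ((a i * g i (x i) : ℝ) : ℂ) * Complex.exp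
      ((u * (weightedSum a g x - residualIncrement ρ a g i x) : ℝ) * Complex.I) ∂μ = 0 := fun i => by
    have h := H.integral_mul_residual_eq_zero (a := a) hg hmean i
      (φ := fun y : ℝ => Complex.exp ((u * y : ℝ) * Complex.I)) (by fun_prop)
    simp only [Complex.ofReal_mul (a i), mul_assoc (a i : ℂ)]
    rw [integral_const_mul]
    exact mul_eq_zero_of_right _ h
  rw [← integral_const_mul, ← integral_sub hS hT,
    ← sub_zero (∫ x, _ ∂μ), ← Finset.sum_eq_zero (s := Finset.univ) fun i _ => hr0 i,
    ← integral_finsetSum _ fun i _ => hr i,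
    ← integral_sub (f := fun x => _ - _) (hS.sub hT) (integrable_finsetSum _ fun i _ => hr i)]
  have hb : ∀ i, Integrable (fun x => 3 * u ^ 2 * α ^ 3 * Λ ^ 3 * R *
      ∑ j, |ρ i j| * (1 + |x i| + |x j|) ^ 6) μ := fun i =>
    ((H.hasAllMoments_sum_weight i 6).const_mul _).integrable
  refine (norm_integral_le_of_norm_le (integrable_finsetSum Finset.univ fun i _ => hb i)
    (Eventually.of_forall fun x => ?_)).trans ?_
  · refine le_trans (le_of_eq ?_) (norm_sum_le_of_le _ fun i _ =>
      H.norm_stein_remainder_le hg ha u i x)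
    congr 1
    conv_lhs => enter [1, 1, 1]; rw [weightedSum]
    rw [steinKernel]
    push_cast
    simp only [Finset.sum_mul, Finset.mul_sum, ← Finset.sum_sub_distrib]
    exact Finset.sum_congr rfl fun i _ => by ring
  · rw [integral_finsetSum _ fun i _ => hb i]
    calc _ ≤ ∑ _i : ι, 3 * u ^ 2 * α ^ 3 * Λ ^ 3 * R * (64 * R * K) := by
          refine Finset.sum_le_sum fun i _ => ?_
          have hα := (abs_nonneg _).trans (ha i)
          have hΛ := (hg i).nonneg
          have hR := H.row_sum_nonneg i
          rw [integral_const_mul]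
          exact mul_le_mul_of_nonneg_left (H.integral_sum_weight_le i) (by positivity)
      _ = _ := by
          rw [Finset.sum_const, Finset.card_univ, nsmul_eq_mul]
          ring

/-- The characteristic function of a weighted sum approximately satisfies the differential
equation of a Gaussian characteristic function. -/
lemma norm_integral_weightedSum_mul_exp_sub_le (H : StdGaussianVector μ ρ R K)
    (hg : ∀ i, QuadraticGrowth (g i) Λ) (ha : ∀ i, |a i| ≤ α)
    (hmean : ∀ i, ∫ x, g i (x i) ∂μ = 0) (u : ℝ) :
    ‖(∫ x, (weightedSum a g x : ℂ) *
          Complex.exp ((u * weightedSum a g x : ℝ) * Complex.I) ∂μ) -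
        u * Complex.I * ((∫ x, weightedSum a g x ^ 2 ∂μ : ℝ) *
          ∫ x, Complex.exp ((u * weightedSum a g x : ℝ) * Complex.I) ∂μ)‖ ≤
      192 * u ^ 2 * (Fintype.card ι * α ^ 3 * Λ ^ 3 * R ^ 2 * K) +
      |u| * (Real.pi / 2 * √(R * (Fintype.card ι * (576 * Λ ^ 4 * α ^ 4 * R ^ 2 * K)))) := by
  have := H.isGaussian
  have hSm : AEStronglyMeasurable (weightedSum a g) μ :=
    (continuous_weightedSum hg).aestronglyMeasurable
  have hTi := (H.hasAllMoments_steinKernel (a := a) hg).integrable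
  refine (norm_sub_le_norm_sub_add_norm_sub _ _ _).trans (add_le_add
    (H.norm_integral_weightedSum_sub_steinKernel_le hg ha hmean u) ?_)
  rw [← mul_sub, norm_mul, norm_mul, Complex.norm_real, Complex.norm_I, mul_one,
    Real.norm_eq_abs, ← H.integral_steinKernel hg hmean, ← integral_const_mul, ← integral_sub
      (integrable_ofReal_mul_exp hTi hSm u)
      (integrable_ofReal_mul_exp (integrable_const (∫ x, steinKernel ρ a g x ∂μ)) hSm u)]
  refine mul_le_mul_of_nonneg_left (le_trans ?_
    (H.integral_abs_steinKernel_sub_le (a := a) hg ha)) (abs_nonneg u)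
  refine norm_integral_le_of_norm_le (hTi.sub (integrable_const _)).abs
    (Eventually.of_forall fun x => ?_)
  rw [← sub_mul, norm_mul, Complex.norm_exp_ofReal_mul_I, mul_one, ← Complex.ofReal_sub,
    Complex.norm_real, Real.norm_eq_abs]

end StdGaussianVector

/-! ### A differential inequality for characteristic functions -/

section CharFun

variable {E : Type*} [MeasurableSpace E] {μ : Measure E} {S : E → ℝ}

lemma hasDerivAt_integral_exp_mul_I (hS : Integrable S μ) [IsFiniteMeasure μ] (u : ℝ) :
    HasDerivAt (fun u : ℝ => ∫ x, Complex.exp ((u * S x : ℝ) * Complex.I) ∂μ)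
      (∫ x, Complex.I * ((S x : ℂ) * Complex.exp ((u * S x : ℝ) * Complex.I)) ∂μ) u := by
  have hc : ∀ u : ℝ, Continuous fun y : ℝ => Complex.exp ((u * y : ℝ) * Complex.I) :=
    fun u => by fun_prop
  have hm := fun u => (hc u).comp_aestronglyMeasurable hS.1
  refine (hasDerivAt_integral_of_dominated_loc_of_deriv_le (bound := fun x => |S x|)
    (F' := fun u x => Complex.I * ((S x : ℂ) * Complex.exp ((u * S x : ℝ) * Complex.I)))
    (s := Set.univ) Filter.univ_mem (Eventually.of_forall hm) ?_
    ((integrable_ofReal_mul_exp hS hS.1 u).const_mul Complex.I).1 ?_ hS.abs ?_).2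
  · exact (integrable_const (1 : ℝ)).mono' (hm u)
      (Eventually.of_forall fun x => (Complex.norm_exp_ofReal_mul_I _).le)
  · refine Eventually.of_forall fun x y _ => ?_
    rw [norm_mul, norm_mul, Complex.norm_exp_ofReal_mul_I, Complex.norm_I, one_mul, mul_one,
      Complex.norm_real, Real.norm_eq_abs]
  · refine Eventually.of_forall fun x y _ => ?_
    have h1 : HasDerivAt (fun y : ℝ => ((y * S x : ℝ) : ℂ) * Complex.I) (S x * Complex.I) y := by
      have := ((hasDerivAt_id y).mul_const (S x)).ofReal_comp.mul_const Complex.I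
      simpa using this
    refine h1.cexp.congr_deriv ?_
    ring

/-- If the characteristic function of `S` approximately satisfies the differential equation of the
characteristic function of a centered Gaussian, then it is close to it. -/
lemma norm_integral_exp_sub_gaussian_le [IsProbabilityMeasure μ] (hS : Integrable S μ)
    {v δ r : ℝ} (hv : 0 ≤ v)
    (h : ∀ u : ℝ, |u| ≤ |r| → ‖(∫ x, (S x : ℂ) * Complex.exp ((u * S x : ℝ) * Complex.I) ∂μ) -
      u * Complex.I * (v * ∫ x, Complex.exp ((u * S x : ℝ) * Complex.I) ∂μ)‖ ≤ δ) :
    ‖(∫ x, Complex.exp ((r * S x : ℝ) * Complex.I) ∂μ) - Complex.exp (-(r ^ 2 * v / 2) : ℝ)‖ ≤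
      |r| * (Real.exp (r ^ 2 * v / 2) * δ) := by
  set φ : ℝ → ℂ := fun u => ∫ x, Complex.exp ((u * S x : ℝ) * Complex.I) ∂μ with hφ
  have hψ : ∀ u : ℝ, HasDerivAt (fun u : ℝ => Complex.exp (u ^ 2 * v / 2 : ℝ) * φ u)
      (Complex.exp (u ^ 2 * v / 2 : ℝ) * (Complex.I *
        ((∫ x, (S x : ℂ) * Complex.exp ((u * S x : ℝ) * Complex.I) ∂μ) -
          u * Complex.I * (v * φ u)))) u := fun u => by
    have h1 : HasDerivAt (fun u : ℝ => u ^ 2 * v / 2) (u * v) u := by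
      refine (((hasDerivAt_pow 2 u).mul_const v).div_const 2).congr_deriv ?_
      simp
      ring
    have h2 : HasDerivAt φ _ u := hasDerivAt_integral_exp_mul_I hS u
    refine (h1.ofReal_comp.cexp.mul h2).congr_deriv ?_
    rw [integral_const_mul, Complex.ofReal_mul u v]
    linear_combination
      (Complex.exp (u ^ 2 * v / 2 : ℝ) * u * v * φ u) * Complex.I_sq
  have hδ : 0 ≤ δ := (norm_nonneg _).trans (h 0 (by simp))
  have hbound := (convex_Icc (-|r|) |r|).norm_image_sub_le_of_norm_hasDerivWithin_le
    (C := Real.exp (r ^ 2 * v / 2) * δ) (fun u _ => (hψ u).hasDerivWithinAt) (fun u hu => ?_)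
    (x := 0) (y := r) (by simp) (abs_le.1 le_rfl)
  · have h0 : φ 0 = 1 := by simp [hφ]
    simp only [h0, sub_zero, Real.norm_eq_abs] at hbound
    norm_num at hbound
    have hfac : φ r - Complex.exp (-(r ^ 2 * v / 2) : ℝ) = Complex.exp (-(r ^ 2 * v / 2) : ℝ) *
        (Complex.exp (r ^ 2 * v / 2 : ℝ) * φ r - 1) := by
      rw [mul_sub, ← mul_assoc, ← Complex.exp_add]
      simp
    rw [hfac, norm_mul, Complex.norm_exp_ofReal, mul_comm |r|]
    have he : Real.exp (-(r ^ 2 * v / 2)) ≤ 1 := Real.exp_le_one_iff.2 (by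
      have := mul_nonneg (sq_nonneg r) hv
      linarith)
    refine (mul_le_of_le_one_left (norm_nonneg _) he).trans ?_
    simpa using hbound
  · have hu' : |u| ≤ |r| := abs_le.2 hu
    rw [norm_mul, norm_mul, Complex.norm_exp_ofReal, Complex.norm_I, one_mul]
    refine mul_le_mul (Real.exp_le_exp.2 ?_) (h u hu') (norm_nonneg _) (Real.exp_pos _).le
    have := sq_le_sq.2 hu'
    gcongr

end CharFun

/-! ### Second differences of the square root -/

/-- The negated second difference of the square root at `k + 1`. -/
noncomputable def sqrtDefect (k : ℕ) : ℝ :=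
  2 * √((k : ℝ) + 1) - √((k : ℝ) + 2) - √(k : ℝ)

lemma sqrtDefect_nonneg (k : ℕ) : 0 ≤ sqrtDefect k := by
  have hk : (0 : ℝ) ≤ k := k.cast_nonneg
  have h0 := Real.sq_sqrt hk
  have h1 := Real.sq_sqrt (show (0 : ℝ) ≤ (k : ℝ) + 1 by positivity)
  have h2 := Real.sq_sqrt (show (0 : ℝ) ≤ (k : ℝ) + 2 by positivity)
  have := abs_le_of_sq_le_sq (a := √((k : ℝ) + 2) + √(k : ℝ)) (b := 2 * √((k : ℝ) + 1))
    (by nlinarith [sq_nonneg (√((k : ℝ) + 2) - √(k : ℝ))]) (by positivity)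
  rw [sqrtDefect]
  linarith [le_of_abs_le this]

lemma sum_range_sqrtDefect_le_one (m : ℕ) : ∑ k ∈ Finset.range m, sqrtDefect k ≤ 1 := by
  have h : ∑ k ∈ Finset.range m, sqrtDefect k = 1 - (√((m : ℝ) + 1) - √(m : ℝ)) := by
    induction m with
    | zero => simp
    | succ m ih =>
      rw [Finset.sum_range_succ, ih, sqrtDefect]
      push_cast
      rw [show (m : ℝ) + 1 + 1 = m + 2 by ring]
      ring
  have : √(m : ℝ) ≤ √((m : ℝ) + 1) := Real.sqrt_le_sqrt (by linarith)
  linarith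

lemma sum_sqrtDefect_le_one {s : Finset ℕ} {f : ℕ → ℕ} (hf : Set.InjOn f s) :
    ∑ k ∈ s, sqrtDefect (f k) ≤ 1 := by
  rw [← Finset.sum_image (f := sqrtDefect) hf]
  refine (Finset.sum_le_sum_of_subset_of_nonneg (fun k hk => ?_)
    fun k _ _ => sqrtDefect_nonneg k).trans
    (sum_range_sqrtDefect_le_one ((s.image f).sup id + 1))
  exact Finset.mem_range.2 (Nat.lt_succ_of_le (Finset.le_sup (f := id) hk))

lemma sqrtDefect_le_one (k : ℕ) : sqrtDefect k ≤ 1 := by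
  simpa using sum_sqrtDefect_le_one (s := {k}) (f := id) Function.injective_id.injOn

/-- The total weight of the second differences of the square root governing the correlations of
the increment `p` with the others. -/
lemma sum_sqrtDefect_row_le (s : Finset ℕ) (p : ℕ) :
    ∑ q ∈ s, (if q = p then 1 else sqrtDefect (p + q) + sqrtDefect (max p q - min p q - 1)) ≤
      4 := by
  have hsplit : ∀ q, (if q = p then 1 else
      sqrtDefect (p + q) + sqrtDefect (max p q - min p q - 1)) ≤
      (if q = p then 1 else 0) + sqrtDefect (p + q) +
        ((if p < q then sqrtDefect (q - p - 1) else 0) +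
          if q < p then sqrtDefect (p - q - 1) else 0) := fun q => by
    rcases lt_trichotomy q p with h | h | h
    · simp [h, h.ne, h.le, h.not_gt]
    · simp [h, sqrtDefect_nonneg]
    · simp [h, h.ne', h.le, h.not_gt]
  refine (Finset.sum_le_sum fun q _ => hsplit q).trans ?_
  simp only [Finset.sum_add_distrib, ← Finset.sum_filter]
  have h1 : ∑ q ∈ s with q = p, (1 : ℝ) ≤ 1 := by
    rw [Finset.sum_const, nsmul_one]
    have : (s.filter (· = p)).card ≤ 1 := Finset.card_le_one.2 fun a ha b hb =>
      (Finset.mem_filter.1 ha).2.trans (Finset.mem_filter.1 hb).2.symm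
    exact_mod_cast this
  have h2 : ∑ q ∈ s, sqrtDefect (p + q) ≤ 1 :=
    sum_sqrtDefect_le_one fun a _ b _ h => by simpa using h
  have h3 : ∑ q ∈ s with p < q, sqrtDefect (q - p - 1) ≤ 1 :=
    sum_sqrtDefect_le_one (f := fun q => q - p - 1) fun a ha b hb h => by
      simp only [Finset.coe_filter, Set.mem_ofPred_eq] at ha hb h
      omega
  have h4 : ∑ q ∈ s with q < p, sqrtDefect (p - q - 1) ≤ 1 :=
    sum_sqrtDefect_le_one (f := fun q => p - q - 1) fun a ha b hb h => by
      simp only [Finset.coe_filter, Set.mem_ofPred_eq] at ha hb h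
      omega
  linarith

/-! ### Covariances of the increments -/

/-- The covariance of increments of a process with covariance function `covK` over the cells
`[p / n, (p + 1) / n]` and `[q / n, (q + 1) / n]`. -/
noncomputable def incrementCov (n p q : ℕ) : ℝ :=
  covK (((p : ℝ) + 1) / n) (((q : ℝ) + 1) / n) - covK (((p : ℝ) + 1) / n) ((q : ℝ) / n) -
    covK ((p : ℝ) / n) (((q : ℝ) + 1) / n) + covK ((p : ℝ) / n) ((q : ℝ) / n)

lemma covK_symm (s t : ℝ) : covK s t = covK t s := by
  rw [covK, covK, add_comm, abs_sub_comm]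

lemma covK_nonneg {s t : ℝ} (hs : 0 ≤ s) (ht : 0 ≤ t) : 0 ≤ covK s t := by
  refine mul_nonneg (by positivity) (sub_nonneg.2 (Real.sqrt_le_sqrt (abs_le.2 ?_)))
  constructor <;> linarith

lemma covK_div (x y : ℝ) (n : ℕ) :
    covK (x / n) (y / n) = (√(2 * Real.pi))⁻¹ * (√n)⁻¹ * (√(y + x) - √|y - x|) := by
  have hn : (0 : ℝ) ≤ n := n.cast_nonneg
  rw [covK, ← add_div, ← sub_div, abs_div, abs_of_nonneg hn, Real.sqrt_div' _ hn,
    Real.sqrt_div' _ hn]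
  ring

lemma incrementCov_symm (n p q : ℕ) : incrementCov n p q = incrementCov n q p := by
  simp only [incrementCov, covK_symm _ ((q : ℝ) / n), covK_symm _ (((q : ℝ) + 1) / n)]
  ring

lemma incrementCov_self (n p : ℕ) :
    incrementCov n p p = (√(2 * Real.pi))⁻¹ * (√n)⁻¹ * (2 - sqrtDefect (2 * p)) := by
  simp only [incrementCov, covK_div, sqrtDefect]
  have h1 : (p : ℝ) - (p + 1) = -1 := by ring
  have h2 : (p : ℝ) + 1 + (p + 1) = 2 * p + 2 := by ring
  have h3 : (p : ℝ) + 1 + p = 2 * p + 1 := by ring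
  have h4 : (p : ℝ) + (p + 1) = 2 * p + 1 := by ring
  simp only [sub_self, abs_zero, Real.sqrt_zero, add_sub_cancel_left, abs_one, Real.sqrt_one,
    h1, abs_neg, h2, h3, h4, ← two_mul (p : ℝ), Nat.cast_mul, Nat.cast_ofNat]
  ring

lemma incrementCov_of_lt (n : ℕ) {p q : ℕ} (h : p < q) :
    incrementCov n p q = -((√(2 * Real.pi))⁻¹ * (√n)⁻¹ *
      (sqrtDefect (p + q) + sqrtDefect (q - p - 1))) := by
  obtain ⟨d, rfl⟩ := Nat.exists_eq_add_of_lt h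
  rw [show p + d + 1 - p - 1 = d by omega]
  have hd : (0 : ℝ) ≤ d := d.cast_nonneg
  simp only [incrementCov, covK_div, sqrtDefect]
  push_cast
  have h1 : (p : ℝ) + d + 1 + 1 - (p + 1) = d + 1 := by ring
  have h2 : (p : ℝ) + d + 1 - (p + 1) = d := by ring
  have h3 : (p : ℝ) + d + 1 + 1 - p = d + 2 := by ring
  have h4 : (p : ℝ) + d + 1 - p = d + 1 := by ring
  have h5 : (p : ℝ) + d + 1 + 1 + (p + 1) = p + (p + d + 1) + 2 := by ring
  have h6 : (p : ℝ) + d + 1 + (p + 1) = p + (p + d + 1) + 1 := by ring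
  have h7 : (p : ℝ) + d + 1 + 1 + p = p + (p + d + 1) + 1 := by ring
  have h8 : (p : ℝ) + d + 1 + p = p + (p + d + 1) := by ring
  rw [h1, h2, h3, h4, h5, h6, h7, h8, abs_of_nonneg hd, abs_of_nonneg (add_nonneg hd zero_le_one),
    abs_of_nonneg (add_nonneg hd zero_le_two)]
  ring

lemma incrementCov_self_ge (n p : ℕ) :
    (√(2 * Real.pi))⁻¹ * (√n)⁻¹ ≤ incrementCov n p p := by
  rw [incrementCov_self]
  exact le_mul_of_one_le_right (by positivity) (by linarith [sqrtDefect_le_one (2 * p)])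

lemma incrementCov_self_le (n p : ℕ) : incrementCov n p p ≤ (√n)⁻¹ := by
  have h2 : (2 : ℝ) ≤ √(2 * Real.pi) := Real.le_sqrt_of_sq_le (by linarith [Real.pi_gt_three])
  rw [incrementCov_self, mul_right_comm]
  refine mul_le_of_le_one_left (by positivity) ?_
  rw [inv_mul_le_one₀ (by positivity)]
  linarith [sqrtDefect_nonneg (2 * p)]

lemma abs_incrementCov_le (n : ℕ) {p q : ℕ} (h : q ≠ p) :
    |incrementCov n p q| ≤ (√(2 * Real.pi))⁻¹ * (√n)⁻¹ *
      (sqrtDefect (p + q) + sqrtDefect (max p q - min p q - 1)) := by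
  have hnn := fun k l => mul_nonneg (show 0 ≤ (√(2 * Real.pi))⁻¹ * (√n)⁻¹ by positivity)
    (add_nonneg (sqrtDefect_nonneg k) (sqrtDefect_nonneg l))
  rcases h.lt_or_gt with h | h
  · rw [incrementCov_symm, incrementCov_of_lt n h, abs_neg, abs_of_nonneg (hnn _ _),
      max_eq_left h.le, min_eq_right h.le, add_comm q p]
  · rw [incrementCov_of_lt n h, abs_neg, abs_of_nonneg (hnn _ _), max_eq_right h.le,
      min_eq_left h.le]

/-! ### The process and its increments -/

namespace IsHeatGaussian

variable {Ω : Type*} [MeasurableSpace Ω] {P : Measure Ω} {F : ℝ → Ω → ℝ}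

lemma map_sum {κ : Type*} [Fintype κ] (hF : IsHeatGaussian P F) {ts : κ → ℝ}
    (hts : ∀ k, 0 ≤ ts k) (c : κ → ℝ) :
    P.map (fun ω => ∑ k, c k * F (ts k) ω) =
      gaussianReal 0 (∑ k, ∑ l, c k * c l * covK (ts k) (ts l)).toNNReal := by
  let e := (Fintype.equivFin κ).symm
  have hF' := hF.2.2 _ (ts ∘ e) (c ∘ e) fun i => hts (e i)
  have hsum : ∑ k, ∑ l, c k * c l * covK (ts k) (ts l) =
      ∑ i, ∑ j, (c ∘ e) i * (c ∘ e) j * covK ((ts ∘ e) i) ((ts ∘ e) j) := by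
    rw [← e.sum_comp]
    exact Finset.sum_congr rfl fun i _ =>
      (e.sum_comp fun l => c (e i) * c l * covK (ts (e i)) (ts l)).symm
  rw [hsum, ← hF']
  congr 1 with ω
  exact (e.sum_comp fun k => c k * F (ts k) ω).symm

lemma hasGaussianLaw {κ : Type*} [Fintype κ] (hF : IsHeatGaussian P F) {ts : κ → ℝ}
    (hts : ∀ k, 0 ≤ ts k) : HasGaussianLaw (fun ω k => F (ts k) ω) P := by
  classical
  refine ⟨isGaussian_of_map_eq_gaussianReal fun l => ⟨0,
    (∑ k, ∑ k', l (Pi.single k 1) * l (Pi.single k' 1) * covK (ts k) (ts k')).toNNReal, ?_⟩⟩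
  · rw [Measure.map_map l.continuous.measurable (measurable_pi_iff.2 fun k => hF.2.1 (ts k))]
    refine Eq.trans ?_ (hF.map_sum hts fun k => l (Pi.single k 1))
    congr 1 with ω
    exact strongDual_pi_apply l _

lemma integral_sq_sum {κ : Type*} [Fintype κ] (hF : IsHeatGaussian P F) {ts : κ → ℝ}
    (hts : ∀ k, 0 ≤ ts k) {c : κ → ℝ} (hc : ∀ k, 0 ≤ c k) :
    ∫ ω, (∑ k, c k * F (ts k) ω) ^ 2 ∂P = ∑ k, ∑ l, c k * c l * covK (ts k) (ts l) := by
  have hm : Measurable fun ω => ∑ k, c k * F (ts k) ω :=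
    Finset.measurable_sum _ fun k _ => (hF.2.1 (ts k)).const_mul (c k)
  have h := integral_map (μ := P) hm.aemeasurable (f := fun x : ℝ => x ^ 2)
    (by fun_prop)
  rw [← h, hF.map_sum hts c]
  have hv := variance_of_integral_eq_zero (X := id) (μ := gaussianReal 0
    (∑ k, ∑ l, c k * c l * covK (ts k) (ts l)).toNNReal) aemeasurable_id integral_id_gaussianReal
  rw [variance_id_gaussianReal, Real.coe_toNNReal _ (Finset.sum_nonneg fun k _ =>
    Finset.sum_nonneg fun l _ => mul_nonneg (mul_nonneg (hc k) (hc l))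
      (covK_nonneg (hts k) (hts l)))] at hv
  exact hv.symm

lemma memLp (hF : IsHeatGaussian P F) {s : ℝ} (hs : 0 ≤ s) : MemLp (F s) 2 P :=
  ((hF.hasGaussianLaw (ts := fun _ : Unit => s) fun _ => hs).eval ()).memLp (by simp)

lemma integral_eq_zero (hF : IsHeatGaussian P F) {s : ℝ} (hs : 0 ≤ s) : ∫ ω, F s ω ∂P = 0 := by
  have h := hF.map_sum (ts := fun _ : Unit => s) (fun _ => hs) fun _ => 1
  simp only [Finset.univ_unique, Finset.sum_singleton, one_mul] at h
  have h2 := integral_map (μ := P) (hF.2.1 s).aemeasurable (f := fun x : ℝ => x)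
    (by fun_prop)
  rw [h, integral_id_gaussianReal] at h2
  exact h2.symm

lemma integral_mul (hF : IsHeatGaussian P F) {s t : ℝ} (hs : 0 ≤ s) (ht : 0 ≤ t) :
    ∫ ω, F s ω * F t ω ∂P = covK s t := by
  have hts : ∀ k, 0 ≤ ![s, t] k := fun k => by fin_cases k <;> assumption
  have h1 := hF.integral_sq_sum hts (c := fun _ => 1) fun _ => zero_le_one
  have h2 := hF.integral_sq_sum hts (c := ![1, 0]) fun k => by fin_cases k <;> simp
  have h3 := hF.integral_sq_sum hts (c := ![0, 1]) fun k => by fin_cases k <;> simp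
  simp only [Fin.sum_univ_two, Matrix.cons_val_zero, Matrix.cons_val_one, one_mul, zero_mul,
    add_zero, zero_add, mul_zero, Matrix.cons_val_fin_one] at h1 h2 h3
  have hst : Integrable (fun ω => F s ω * F t ω) P := (hF.memLp hs).integrable_mul (hF.memLp ht)
  have hexp : ∀ ω, (F s ω + F t ω) ^ 2 = F s ω ^ 2 + F t ω ^ 2 + 2 * (F s ω * F t ω) :=
    fun ω => by ring
  simp_rw [hexp] at h1
  have hsq : Integrable (fun ω => F s ω ^ 2 + F t ω ^ 2) P :=
    (hF.memLp hs).integrable_sq.add (hF.memLp ht).integrable_sq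
  rw [integral_add hsq (hst.const_mul 2), integral_add (hF.memLp hs).integrable_sq (hF.memLp ht).integrable_sq,
    integral_const_mul, h2, h3, covK_symm t s] at h1
  linarith

end IsHeatGaussian

/-- The increment of `F` over `[p / n, (p + 1) / n]`. -/
noncomputable def heatIncrement {Ω : Type*} (F : ℝ → Ω → ℝ) (n p : ℕ) (ω : Ω) : ℝ :=
  F (((p : ℝ) + 1) / n) ω - F ((p : ℝ) / n) ω

/-- The increment of `F` over `[p / n, (p + 1) / n]`, normalized to have variance one. -/
noncomputable def stdIncrement {Ω : Type*} (F : ℝ → Ω → ℝ) (n p : ℕ) (ω : Ω) : ℝ :=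
  (√(incrementCov n p p))⁻¹ * heatIncrement F n p ω

namespace IsHeatGaussian

variable {Ω : Type*} [MeasurableSpace Ω] {P : Measure Ω} {F : ℝ → Ω → ℝ}

lemma integral_heatIncrement (hF : IsHeatGaussian P F) (n p : ℕ) :
    ∫ ω, heatIncrement F n p ω ∂P = 0 := by
  have := hF.1
  have h1 : 0 ≤ ((p : ℝ) + 1) / n := by positivity
  have h2 : 0 ≤ (p : ℝ) / n := by positivity
  simp only [heatIncrement]
  rw [integral_sub ((hF.memLp h1).integrable (by simp)) ((hF.memLp h2).integrable (by simp)),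
    hF.integral_eq_zero h1, hF.integral_eq_zero h2, sub_zero]

lemma integral_heatIncrement_mul (hF : IsHeatGaussian P F) (n p q : ℕ) :
    ∫ ω, heatIncrement F n p ω * heatIncrement F n q ω ∂P = incrementCov n p q := by
  have h1 : 0 ≤ ((p : ℝ) + 1) / n := by positivity
  have h2 : 0 ≤ (p : ℝ) / n := by positivity
  have h3 : 0 ≤ ((q : ℝ) + 1) / n := by positivity
  have h4 : 0 ≤ (q : ℝ) / n := by positivity
  have hi : ∀ {s t : ℝ}, 0 ≤ s → 0 ≤ t → Integrable (fun ω => F s ω * F t ω) P :=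
    fun hs ht => (hF.memLp hs).integrable_mul (hF.memLp ht)
  have hi2 : Integrable (fun ω => F (((p : ℝ) + 1) / n) ω * F (((q : ℝ) + 1) / n) ω -
      F (((p : ℝ) + 1) / n) ω * F ((q : ℝ) / n) ω) P := (hi h1 h3).sub (hi h1 h4)
  have hi3 : Integrable (fun ω => F (((p : ℝ) + 1) / n) ω * F (((q : ℝ) + 1) / n) ω -
      F (((p : ℝ) + 1) / n) ω * F ((q : ℝ) / n) ω -
      F ((p : ℝ) / n) ω * F (((q : ℝ) + 1) / n) ω) P := hi2.sub (hi h2 h3)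
  have hexp : ∀ ω, heatIncrement F n p ω * heatIncrement F n q ω =
      F (((p : ℝ) + 1) / n) ω * F (((q : ℝ) + 1) / n) ω -
        F (((p : ℝ) + 1) / n) ω * F ((q : ℝ) / n) ω -
        F ((p : ℝ) / n) ω * F (((q : ℝ) + 1) / n) ω + F ((p : ℝ) / n) ω * F ((q : ℝ) / n) ω :=
    fun ω => by
      simp only [heatIncrement]
      ring
  simp_rw [hexp]
  rw [integral_add hi3 (hi h2 h4), integral_sub hi2 (hi h2 h3), integral_sub (hi h1 h3) (hi h1 h4),
    hF.integral_mul h1 h3, hF.integral_mul h1 h4, hF.integral_mul h2 h3, hF.integral_mul h2 h4,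
    incrementCov]

lemma integral_stdIncrement_mul (hF : IsHeatGaussian P F) (n p q : ℕ) :
    ∫ ω, stdIncrement F n p ω * stdIncrement F n q ω ∂P =
      (√(incrementCov n p p))⁻¹ * (√(incrementCov n q q))⁻¹ * incrementCov n p q := by
  have hexp : ∀ ω, stdIncrement F n p ω * stdIncrement F n q ω =
      (√(incrementCov n p p))⁻¹ * (√(incrementCov n q q))⁻¹ *
        (heatIncrement F n p ω * heatIncrement F n q ω) := fun ω => by
    simp only [stdIncrement]
    ring
  simp_rw [hexp]
  rw [integral_const_mul, hF.integral_heatIncrement_mul]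

lemma hasGaussianLaw_stdIncrement {κ : Type*} [Fintype κ] (hF : IsHeatGaussian P F) (n : ℕ)
    (f : κ → ℕ) : HasGaussianLaw (fun ω k => stdIncrement F n (f k) ω) P := by
  have h := hF.hasGaussianLaw
    (ts := Sum.elim (fun k => ((f k : ℝ) + 1) / n) fun k => (f k : ℝ) / n) fun k => by
      rcases k with k | k
      · exact div_nonneg (add_nonneg (Nat.cast_nonneg _) zero_le_one) (Nat.cast_nonneg _)
      · exact div_nonneg (Nat.cast_nonneg _) (Nat.cast_nonneg _)
  let l : (κ ⊕ κ → ℝ) →L[ℝ] (κ → ℝ) := ContinuousLinearMap.pi fun k =>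
    (√(incrementCov n (f k) (f k)))⁻¹ •
      (ContinuousLinearMap.proj (R := ℝ) (φ := fun _ : κ ⊕ κ => ℝ) (Sum.inl k) -
        ContinuousLinearMap.proj (Sum.inr k))
  exact h.map_fun l

end IsHeatGaussian

lemma incrementCov_self_pos {n : ℕ} (hn : 0 < n) (p : ℕ) : 0 < incrementCov n p p :=
  lt_of_lt_of_le (by positivity) (incrementCov_self_ge n p)

namespace IsHeatGaussian

variable {Ω : Type*} [MeasurableSpace Ω] {P : Measure Ω} {F : ℝ → Ω → ℝ}

lemma integral_stdIncrement_mul_self (hF : IsHeatGaussian P F) {n : ℕ} (hn : 0 < n) (p : ℕ) :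
    ∫ ω, stdIncrement F n p ω * stdIncrement F n p ω ∂P = 1 := by
  have h := incrementCov_self_pos hn p
  rw [hF.integral_stdIncrement_mul, ← mul_inv, Real.mul_self_sqrt h.le, inv_mul_cancel₀ h.ne']

lemma map_stdIncrement (hF : IsHeatGaussian P F) {n : ℕ} (hn : 0 < n) (p : ℕ) :
    P.map (stdIncrement F n p) = gaussianReal 0 1 := by
  have hG := (hF.hasGaussianLaw_stdIncrement n fun _ : Unit => p).eval ()
  have h0 : ∫ ω, stdIncrement F n p ω ∂P = 0 := by
    simp only [stdIncrement]
    rw [integral_const_mul, hF.integral_heatIncrement, mul_zero]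
  have h := hG.map_eq_gaussianReal
  rw [variance_of_integral_eq_zero hG.aemeasurable h0] at h
  simp_rw [sq] at h
  rw [hF.integral_stdIncrement_mul_self hn] at h
  simpa [h0] using h

lemma abs_integral_stdIncrement_mul_le (hF : IsHeatGaussian P F) {n : ℕ} (hn : 0 < n) (p q : ℕ) :
    |∫ ω, stdIncrement F n p ω * stdIncrement F n q ω ∂P| ≤
      if q = p then 1 else sqrtDefect (p + q) + sqrtDefect (max p q - min p q - 1) := by
  split_ifs with h
  · rw [h, hF.integral_stdIncrement_mul_self hn, abs_one]
  · set c := (√(2 * Real.pi))⁻¹ * (√n)⁻¹ with hc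
    have hc0 : 0 < c := by positivity
    rw [hF.integral_stdIncrement_mul, abs_mul, abs_of_nonneg (by positivity)]
    calc _ ≤ (√c)⁻¹ * (√c)⁻¹ *
          (c * (sqrtDefect (p + q) + sqrtDefect (max p q - min p q - 1))) := by
          gcongr
          · exact incrementCov_self_ge n p
          · exact incrementCov_self_ge n q
          · exact abs_incrementCov_le n h
      _ = _ := by
          rw [← mul_inv, Real.mul_self_sqrt hc0.le, inv_mul_cancel_left₀ hc0.ne']

/-- The normalized increments form a standardized Gaussian vector with uniformly summable
correlations. -/
lemma stdGaussianVector (hF : IsHeatGaussian P F) {n : ℕ} (hn : 0 < n) (s : Finset ℕ) :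
    StdGaussianVector (P.map fun ω (p : s) => stdIncrement F n p ω)
      (fun p q => ∫ ω, stdIncrement F n p ω * stdIncrement F n q ω ∂P) 4
      (∫ x, (1 + |x|) ^ 6 ∂gaussianReal 0 1) := by
  have hX := hF.hasGaussianLaw_stdIncrement n fun p : s => (p : ℕ)
  have hm : ∀ p, Measurable (stdIncrement F n p) := fun p =>
    ((hF.2.1 _).sub (hF.2.1 _)).const_mul _
  have heval : ∀ p : s, (P.map fun ω (p : s) => stdIncrement F n p ω).map (fun x => x p) =
      gaussianReal 0 1 := fun p => by
    rw [Measure.map_map (measurable_pi_apply p) (measurable_pi_iff.2 fun p => hm p)]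
    exact hF.map_stdIncrement hn p
  refine ⟨hX.isGaussian_map, fun p => ?_, fun p q => ?_, fun p =>
    hF.integral_stdIncrement_mul_self hn p, fun p => ?_, fun p => le_of_eq ?_⟩
  · have h := integral_map (μ := P.map fun ω (p : s) => stdIncrement F n p ω)
      (measurable_pi_apply p).aemeasurable (f := fun y : ℝ => y) (by fun_prop)
    rw [heval, integral_id_gaussianReal] at h
    exact h.symm
  · rw [integral_map hX.aemeasurable (by fun_prop)]
  · rw [Finset.sum_coe_sort s fun q => |∫ ω, stdIncrement F n p ω * stdIncrement F n q ω ∂P|]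
    exact (Finset.sum_le_sum fun q _ => hF.abs_integral_stdIncrement_mul_le hn p q).trans
      (sum_sqrtDefect_row_le s p)
  · rw [← heval p, integral_map (measurable_pi_apply p).aemeasurable (by fun_prop)]

end IsHeatGaussian

/-! ### Convergence of the characteristic functions -/

lemma StdGaussianVector.norm_integral_exp_weightedSum_sub_le {ι : Type*} [Fintype ι]
    {μ : Measure (ι → ℝ)} {ρ : ι → ι → ℝ} {R K : ℝ} (H : StdGaussianVector μ ρ R K)
    {a : ι → ℝ} {g : ι → ℝ → ℝ} {α Λ T : ℝ} (hR : 0 ≤ R) (hK : 0 ≤ K) (hα : 0 ≤ α) (hΛ : 0 ≤ Λ)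
    (hg : ∀ i, QuadraticGrowth (g i) Λ) (ha : ∀ i, |a i| ≤ α)
    (hmean : ∀ i, ∫ x, g i (x i) ∂μ = 0) (hcard : Fintype.card ι * α ^ 2 ≤ T) (r : ℝ) :
    ‖(∫ x, Complex.exp ((r * weightedSum a g x : ℝ) * Complex.I) ∂μ) -
        Complex.exp (-(r ^ 2 * (∫ x, weightedSum a g x ^ 2 ∂μ) / 2) : ℝ)‖ ≤
      |r| * (Real.exp (r ^ 2 * (∫ x, weightedSum a g x ^ 2 ∂μ) / 2) *
        (192 * r ^ 2 * (T * α * Λ ^ 3 * R ^ 2 * K) +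
          |r| * (Real.pi / 2 * √(R * (576 * Λ ^ 4 * (T * α ^ 2) * R ^ 2 * K))))) := by
  have := H.isGaussian
  have hS := (H.hasAllMoments_weightedSum (a := a) hg).integrable
  refine norm_integral_exp_sub_gaussian_le hS (integral_nonneg fun x => sq_nonneg _)
    fun u hu => (H.norm_integral_weightedSum_mul_exp_sub_le hg ha hmean u).trans ?_
  have h3 : Fintype.card ι * α ^ 3 ≤ T * α := by
    calc (Fintype.card ι : ℝ) * α ^ 3 = Fintype.card ι * α ^ 2 * α := by ring
      _ ≤ _ := by gcongr
  refine add_le_add ?_ ?_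
  · gcongr ?_ * ?_ * (?_ * _ * _ * _)
    exact sq_le_sq.2 hu
  · refine mul_le_mul hu ?_ (by positivity) (abs_nonneg r)
    refine mul_le_mul_of_nonneg_left (Real.sqrt_le_sqrt (mul_le_mul_of_nonneg_left ?_ hR))
      (by positivity)
    calc _ = 576 * Λ ^ 4 * (Fintype.card ι * α ^ 2 * α ^ 2) * R ^ 2 * K := by ring
      _ ≤ _ := by gcongr

lemma QuadraticGrowth.of_assumption31 {ι : Type*} {h : ι → ℝ → ℝ} {L : ℝ}
    (hA : Assumption31 h L) (j : ι) : QuadraticGrowth (h j) (√L) := by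
  obtain ⟨hC, h0, h1, hLip, -, -⟩ := hA
  refine quadraticGrowth_of_lipschitz_deriv (Real.sqrt_nonneg L) (hC j)
    (Real.abs_le_sqrt (h0 j)) (Real.abs_le_sqrt (h1 j)) fun x y => ?_
  obtain ⟨l, hl, hlip⟩ := hLip j
  exact (hlip x y).trans (mul_le_mul_of_nonneg_right
    ((le_abs_self l).trans (Real.abs_le_sqrt hl)) (abs_nonneg _))

section Increments

variable {Ω : Type*} [MeasurableSpace Ω] {P : Measure Ω} {F : ℝ → Ω → ℝ}

lemma Bproc_eq_sum_range (hF : IsHeatGaussian P F) (h : ℕ → ℝ → ℝ) (n : ℕ) (t : ℝ) (ω : Ω) :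
    Bproc P F h n t ω = ∑ p ∈ Finset.range ⌊(n : ℝ) * t⌋₊,
      incrementCov n p p * h (p + 1) (stdIncrement F n p ω) := by
  refine (Finset.sum_nbij' (· + 1) (· - 1) (fun p hp => ?_) (fun j hj => ?_) (fun p _ => rfl)
    (fun j hj => Nat.sub_add_cancel (Finset.mem_Icc.1 hj).1) fun p _ => ?_).symm
  · rw [Finset.mem_range] at hp
    rw [Finset.mem_Icc]
    omega
  · rw [Finset.mem_Icc] at hj
    rw [Finset.mem_range]
    omega
  · simp only [Nat.cast_add, Nat.cast_one, add_sub_cancel_right, stdIncrement, heatIncrement,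
      ← hF.integral_heatIncrement_mul n p p, sq]

lemma Bproc_sub_eq_weightedSum (hF : IsHeatGaussian P F) (h : ℕ → ℝ → ℝ) (n : ℕ) {s t : ℝ}
    (hst : s ≤ t) (ω : Ω) :
    Bproc P F h n t ω - Bproc P F h n s ω =
      weightedSum (fun p : Finset.Ico ⌊(n : ℝ) * s⌋₊ ⌊(n : ℝ) * t⌋₊ => incrementCov n p p)
        (fun p => h (p + 1)) (fun p => stdIncrement F n p ω) := by
  have hle : ⌊(n : ℝ) * s⌋₊ ≤ ⌊(n : ℝ) * t⌋₊ :=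
    Nat.floor_mono (mul_le_mul_of_nonneg_left hst n.cast_nonneg)
  rw [Bproc_eq_sum_range hF, Bproc_eq_sum_range hF, ← Finset.sum_Ico_eq_sub _ hle, weightedSum]
  exact (Finset.sum_coe_sort _ fun p => incrementCov n p p * h (p + 1) (stdIncrement F n p ω)).symm

lemma measurable_Bproc_sub (hF : IsHeatGaussian P F) {h : ℕ → ℝ → ℝ} {L : ℝ}
    (hA : Assumption31 h L) (n : ℕ) {s t : ℝ} :
    Measurable fun ω => Bproc P F h n t ω - Bproc P F h n s ω := by
  have hm : ∀ t, Measurable (Bproc P F h n t) := fun t =>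
    Finset.measurable_sum _ fun j _ => ((hA.1 j).continuous.measurable.comp
      (((hF.2.1 _).sub (hF.2.1 _)).const_mul _)).const_mul _
  exact (hm t).sub (hm s)

lemma norm_integral_exp_Bproc_sub_le (hF : IsHeatGaussian P F) {h : ℕ → ℝ → ℝ} {L : ℝ}
    (hA : Assumption31 h L) {n : ℕ} (hn : 0 < n) {s t : ℝ} (hst : s ≤ t) (ht : 0 ≤ t) (r : ℝ) :
    ‖(∫ ω, Complex.exp ((r * (Bproc P F h n t ω - Bproc P F h n s ω) : ℝ) * Complex.I) ∂P) -
        Complex.exp (-(r ^ 2 * (∫ ω, (Bproc P F h n t ω - Bproc P F h n s ω) ^ 2 ∂P) / 2) : ℝ)‖ ≤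
      |r| * (Real.exp (r ^ 2 * (∫ ω, (Bproc P F h n t ω - Bproc P F h n s ω) ^ 2 ∂P) / 2) *
        (192 * r ^ 2 * (t * (√n)⁻¹ * √L ^ 3 * 4 ^ 2 * ∫ x, (1 + |x|) ^ 6 ∂gaussianReal 0 1) +
          |r| * (Real.pi / 2 * √(4 * (576 * √L ^ 4 * (t * (√n)⁻¹ ^ 2) * 4 ^ 2 *
            ∫ x, (1 + |x|) ^ 6 ∂gaussianReal 0 1))))) := by
  have hn' : (0 : ℝ) < n := Nat.cast_pos.2 hn
  set A := Finset.Ico ⌊(n : ℝ) * s⌋₊ ⌊(n : ℝ) * t⌋₊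
  set X : Ω → A → ℝ := fun ω p => stdIncrement F n p ω
  have hg : ∀ p : A, QuadraticGrowth (h (p + 1)) (√L) := fun p => .of_assumption31 hA _
  have hX : AEMeasurable X P := (hF.hasGaussianLaw_stdIncrement n fun p : A => (p : ℕ)).aemeasurable
  have hSc := continuous_weightedSum (a := fun p : A => incrementCov n p p) hg
  have hcard : (Fintype.card A : ℝ) * (√n)⁻¹ ^ 2 ≤ t := by
    rw [inv_pow, Real.sq_sqrt hn'.le, ← div_eq_mul_inv, div_le_iff₀ hn', mul_comm t]
    refine le_trans ?_ (Nat.floor_le (mul_nonneg hn'.le ht))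
    rw [Fintype.card_coe, Nat.card_Ico]
    exact_mod_cast Nat.sub_le _ _
  have hmean : ∀ p : A, ∫ x, h (p + 1) (x p) ∂P.map X = 0 := fun p => by
    have hc : Continuous (h (p + 1)) := (hA.1 _).continuous
    rw [integral_map hX (f := fun x => h (p + 1) (x p))
        (hc.comp (continuous_apply p)).aestronglyMeasurable,
      ← integral_map (φ := stdIncrement F n p) (((hF.2.1 _).sub (hF.2.1 _)).const_mul _).aemeasurable
        hc.aestronglyMeasurable, hF.map_stdIncrement hn]
    exact hA.2.2.2.2.1 _
  have key := (hF.stdGaussianVector hn A).norm_integral_exp_weightedSum_sub_le (by norm_num)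
    (integral_nonneg fun x => by positivity) (by positivity) (Real.sqrt_nonneg L) hg
    (fun p => (abs_of_pos (incrementCov_self_pos hn p)).le.trans (incrementCov_self_le n p))
    hmean hcard r
  rw [integral_map hX (by fun_prop), integral_map hX (by fun_prop)] at key
  simpa only [Bproc_sub_eq_weightedSum hF h n hst] using key

lemma tendsto_integral_exp_Bproc_sub (hF : IsHeatGaussian P F) {h : ℕ → ℝ → ℝ} {L : ℝ}
    (hA : Assumption31 h L) {s t v : ℝ} (hst : s ≤ t) (ht : 0 ≤ t)
    (hvar : Tendsto (fun n : ℕ => ∫ ω, (Bproc P F h n t ω - Bproc P F h n s ω) ^ 2 ∂P)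
      atTop (nhds v)) (r : ℝ) :
    Tendsto (fun n : ℕ => ∫ ω, Complex.exp
        ((r * (Bproc P F h n t ω - Bproc P F h n s ω) : ℝ) * Complex.I) ∂P)
      atTop (nhds (Complex.exp (-(r ^ 2 * v / 2) : ℝ))) := by
  have hsqrt : Tendsto (fun n : ℕ => (√n)⁻¹) atTop (nhds 0) :=
    tendsto_inv_atTop_zero.comp (Real.tendsto_sqrt_atTop.comp tendsto_natCast_atTop_atTop)
  have hexp : Tendsto (fun n : ℕ => Complex.exp
      (-(r ^ 2 * (∫ ω, (Bproc P F h n t ω - Bproc P F h n s ω) ^ 2 ∂P) / 2) : ℝ))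
      atTop (nhds (Complex.exp (-(r ^ 2 * v / 2) : ℝ))) :=
    ((by fun_prop : Continuous fun v : ℝ => Complex.exp (-(r ^ 2 * v / 2) : ℝ)).tendsto v).comp hvar
  have hcont : Continuous fun x : ℝ × ℝ => |r| * (Real.exp (r ^ 2 * x.1 / 2) *
        (192 * r ^ 2 * (t * x.2 * √L ^ 3 * 4 ^ 2 * ∫ x, (1 + |x|) ^ 6 ∂gaussianReal 0 1) +
          |r| * (Real.pi / 2 * √(4 * (576 * √L ^ 4 * (t * x.2 ^ 2) * 4 ^ 2 *
            ∫ x, (1 + |x|) ^ 6 ∂gaussianReal 0 1))))) := by fun_prop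
  have hbound := (hcont.tendsto (v, 0)).comp (hvar.prodMk_nhds hsqrt)
  simp only [mul_zero, zero_mul, ne_eq, OfNat.ofNat_ne_zero, not_false_eq_true, zero_pow,
    Real.sqrt_zero, add_zero] at hbound
  have hdiff := squeeze_zero_norm' ((eventually_gt_atTop 0).mono fun n hn =>
    norm_integral_exp_Bproc_sub_le hF hA hn hst ht r) hbound
  simpa using hdiff.add hexp

end Increments

/-- Lemma 3.6: if `E|B_n(t) − B_n(s)|² → κ²(t−s)`, then the law of
`B_n(t) − B_n(s)` converges weakly to the centered Gaussian law with variance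
`κ²(t−s)`. -/
theorem Bproc_increment_clt {Ω : Type*} [MeasurableSpace Ω]
    (P : Measure Ω) (F : ℝ → Ω → ℝ) (hF : IsHeatGaussian P F)
    (h : ℕ → ℝ → ℝ) (L : ℝ) (hL : 0 ≤ L) (hA : Assumption31 h L)
    (s t : ℝ) (hs : 0 ≤ s) (hst : s < t) (κ : ℝ) (hκ : 0 ≤ κ)
    (hvar : Tendsto
      (fun n : ℕ => ∫ ω, (Bproc P F h n t ω - Bproc P F h n s ω) ^ 2 ∂P)
      atTop (nhds (κ ^ 2 * (t - s)))) :
    ∀ g : BoundedContinuousFunction ℝ ℝ,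
      Tendsto (fun n : ℕ => ∫ ω, g (Bproc P F h n t ω - Bproc P F h n s ω) ∂P)
        atTop
        (nhds (∫ x, g x ∂(gaussianReal 0 (Real.toNNReal (κ ^ 2 * (t - s)))))) := by
  have := hF.1
  have hm : ∀ n, AEMeasurable (fun ω => Bproc P F h n t ω - Bproc P F h n s ω) P :=
    fun n => (measurable_Bproc_sub hF hA n).aemeasurable
  let ν : ℕ → ProbabilityMeasure ℝ := fun n =>
    ⟨P.map fun ω => Bproc P F h n t ω - Bproc P F h n s ω, Measure.isProbabilityMeasure_map (hm n)⟩
  let γ : ProbabilityMeasure ℝ :=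
    ⟨gaussianReal 0 (κ ^ 2 * (t - s)).toNNReal, inferInstance⟩
  have hv : 0 ≤ κ ^ 2 * (t - s) := mul_nonneg (sq_nonneg κ) (sub_nonneg.2 hst.le)
  have hν : Tendsto ν atTop (nhds γ) := by
    refine ProbabilityMeasure.tendsto_iff_tendsto_charFun.2 fun r => ?_
    have hlim := tendsto_integral_exp_Bproc_sub hF hA hst.le (hs.trans hst.le) hvar r
    convert hlim using 2 with n
    · simp only [ν, ProbabilityMeasure.coe_mk, charFun_apply_real]
      rw [integral_map (hm n) (by fun_prop)]
      simp
    · simp only [γ, ProbabilityMeasure.coe_mk, charFun_gaussianReal, Real.coe_toNNReal _ hv]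
      push_cast
      ring_nf
  intro g
  have hg := ProbabilityMeasure.tendsto_iff_forall_integral_tendsto.1 hν g
  refine hg.congr fun n => ?_
  exact integral_map (hm n) g.continuous.aestronglyMeasurable
end

section
/- For every L ≥ 0 there exists a finite constant C, depending only on L, with the following property. Let h_1, …, h_4 : ℝ → ℝ and L satisfy the deterministic form of Assumption 3.1, and let (X_1, …, X_4) be a centered jointly Gaussian random vector with E[X_j²] = 1 and ρ_{ij} = E[X_i X_j]. If |ρ_{12}| < 1, then |E[h_1(X_1) h_2(X_2) h_3(X_3) h_4(X_4)]| ≤ C ( |ρ_{12} ρ_{34}| + (1 − ρ_{12}²)^{-1/2} · max{ |ρ_{ij}| : i ∈ {1,2}, j ∈ {3,4} } ). -/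
open MeasureTheory ProbabilityTheory Filter

/-- A finite family of random variables is centered jointly Gaussian if every
linear combination of them has a centered Gaussian law. -/
def JointlyGaussianVec {Ω : Type*} [MeasurableSpace Ω] (P : Measure Ω)
    {m : ℕ} (X : Fin m → Ω → ℝ) : Prop :=
  ∀ v : Fin m → ℝ, ∃ σ : NNReal,
    Measure.map (fun ω => ∑ i, v i * X i ω) P = gaussianReal 0 σ

lemma abs_sub_le_of_lipschitz_deriv {f : ℝ → ℝ} {K : ℝ} (hf : Differentiable ℝ f)
    (h0 : |deriv f 0| ≤ K) (hl : ∀ x y, |deriv f x - deriv f y| ≤ K * |x - y|)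
    {T x y : ℝ} (hx : |x| ≤ T) (hy : |y| ≤ T) :
    |f x - f y| ≤ K * (1 + T) * |x - y| := by
  have hK : 0 ≤ K := (abs_nonneg _).trans h0
  refine Convex.norm_image_sub_le_of_norm_deriv_le (s := Set.Icc (-T) T) (𝕜 := ℝ)
    (fun z _ => hf z) (fun z hz => ?_) (convex_Icc _ _) (abs_le.1 hy) (abs_le.1 hx)
  have hz' : |z| ≤ T := abs_le.2 hz
  have h1 := hl z 0
  have h2 := abs_sub_abs_le_abs_sub (deriv f z) (deriv f 0)
  rw [sub_zero] at h1
  rw [Real.norm_eq_abs]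
  nlinarith [mul_le_mul_of_nonneg_left hz' hK]

lemma abs_le_of_lipschitz_deriv {f : ℝ → ℝ} {K : ℝ} (hf : Differentiable ℝ f)
    (hf0 : |f 0| ≤ K) (h0 : |deriv f 0| ≤ K)
    (hl : ∀ x y, |deriv f x - deriv f y| ≤ K * |x - y|) {T x : ℝ} (hx : |x| ≤ T) :
    |f x| ≤ K * (1 + T) ^ 2 := by
  have hK : 0 ≤ K := (abs_nonneg _).trans h0
  have hT : 0 ≤ T := (abs_nonneg _).trans hx
  have h1 := abs_sub_le_of_lipschitz_deriv hf h0 hl hx (y := 0) (by simpa using hT)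
  have h2 := abs_sub_abs_le_abs_sub (f x) (f 0)
  rw [sub_zero] at h1
  have h3 := mul_le_mul_of_nonneg_left hx (mul_nonneg hK (by linarith : 0 ≤ 1 + T))
  nlinarith [mul_nonneg hK hT]

section Residual

variable {ρ : Fin 4 → Fin 4 → ℝ} {s b : ℝ} {j : Fin 4}

/-- The coefficients of the residual of the `j`-th coordinate after regression on the first two. -/
noncomputable def residualCoeff (ρ : Fin 4 → Fin 4 → ℝ) (s b : ℝ) (j : Fin 4) : Fin 4 → ℝ :=
  Pi.single j 1 + Pi.single 0 (b * ρ 0 1 / s - ρ 0 j) + Pi.single 1 (-(b / s))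

lemma sum_single_mul_residualCoeff (p : Fin 4) :
    ∑ i, ∑ k, (Pi.single p 1 : Fin 4 → ℝ) i * residualCoeff ρ s b j k * ρ i k =
      ρ p j + (b * ρ 0 1 / s - ρ 0 j) * ρ p 0 - b / s * ρ p 1 := by
  simp [residualCoeff, Pi.single_apply, add_mul, Finset.sum_add_distrib]
  ring

lemma sum_residualCoeff_mul_residualCoeff (hsymm : ∀ i k, ρ i k = ρ k i)
    (hdiag : ∀ i, ρ i i = 1) (hs : s ≠ 0) (hs2 : s ^ 2 = 1 - ρ 0 1 ^ 2)
    (hb : ρ 1 j = b * s + ρ 0 1 * ρ 0 j) :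
    ∑ i, ∑ k, residualCoeff ρ s b j i * residualCoeff ρ s b j k * ρ i k =
      1 - ρ 0 j ^ 2 - b ^ 2 := by
  simp [residualCoeff, Pi.single_apply, add_mul, mul_add, Finset.sum_add_distrib, hdiag,
    hsymm j 0, hsymm j 1, hsymm 1 0, hb]
  field_simp
  linear_combination (-b ^ 2) * hs2

end Residual

section Gaussian

variable {Ω : Type*} [MeasurableSpace Ω] {P : Measure Ω}

lemma JointlyGaussianVec.hasGaussianLaw {m : ℕ} {X : Fin m → Ω → ℝ}
    (hX : ∀ i, Measurable (X i)) (h : JointlyGaussianVec P X) :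
    HasGaussianLaw (fun ω i => X i ω) P where
  isGaussian_map := by
    refine isGaussian_of_map_eq_gaussianReal fun L => ?_
    obtain ⟨σ, hσ⟩ := h fun i => L (Pi.single i 1)
    refine ⟨0, σ, ?_⟩
    rw [Measure.map_map (by fun_prop) (by fun_prop), ← hσ]
    congr 1
    ext ω
    have := L.toLinearMap.pi_apply_eq_sum_univ (fun i => X i ω)
    simp only [ContinuousLinearMap.coe_coe, smul_eq_mul] at this
    simp only [Function.comp_apply, this]
    refine Finset.sum_congr rfl fun i _ => ?_
    rw [mul_comm]
    congr 2
    ext j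
    simp [Pi.single_apply, eq_comm]

lemma JointlyGaussianVec.memLp {m : ℕ} {X : Fin m → Ω → ℝ}
    (hX : ∀ i, Measurable (X i)) (h : JointlyGaussianVec P X) (i : Fin m) :
    MemLp (X i) 2 P :=
  ((h.hasGaussianLaw hX).map_fun (ContinuousLinearMap.proj i)).memLp_two

lemma JointlyGaussianVec.integral_sum_mul_sum {m : ℕ} {X : Fin m → Ω → ℝ}
    (hX : ∀ i, Measurable (X i)) (h : JointlyGaussianVec P X) (v w : Fin m → ℝ) :
    ∫ ω, (∑ i, v i * X i ω) * (∑ j, w j * X j ω) ∂P =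
      ∑ i, ∑ j, v i * w j * ∫ ω, X i ω * X j ω ∂P := by
  have hint : ∀ i j, Integrable (fun ω => v i * w j * (X i ω * X j ω)) P := fun i j =>
    ((h.memLp hX i).integrable_mul (h.memLp hX j)).const_mul _
  have : ∀ ω, (∑ i, v i * X i ω) * (∑ j, w j * X j ω) =
      ∑ i, ∑ j, v i * w j * (X i ω * X j ω) := fun ω => by
    rw [Finset.sum_mul_sum]
    exact Finset.sum_congr rfl fun i _ => Finset.sum_congr rfl fun j _ => by ring
  simp_rw [this]
  rw [integral_finsetSum _ fun i _ => integrable_finsetSum _ fun j _ => hint i j]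
  refine Finset.sum_congr rfl fun i _ => ?_
  rw [integral_finsetSum _ fun j _ => hint i j]
  exact Finset.sum_congr rfl fun j _ => integral_const_mul _ _

lemma JointlyGaussianVec.integral_sum {m : ℕ} {X : Fin m → Ω → ℝ}
    (hX : ∀ i, Measurable (X i)) (h : JointlyGaussianVec P X) (v : Fin m → ℝ) :
    ∫ ω, ∑ i, v i * X i ω ∂P = 0 := by
  obtain ⟨σ, hσ⟩ := h v
  have := integral_map (μ := P) (φ := fun ω => ∑ i, v i * X i ω) (by fun_prop)
    (f := fun x : ℝ => x) (by fun_prop)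
  rw [hσ, integral_id_gaussianReal] at this
  exact this.symm

lemma JointlyGaussianVec.map_sum_eq_gaussianReal {m : ℕ} {X : Fin m → Ω → ℝ}
    (hX : ∀ i, Measurable (X i)) (h : JointlyGaussianVec P X) (v : Fin m → ℝ)
    (hv : ∫ ω, (∑ i, v i * X i ω) * (∑ i, v i * X i ω) ∂P = 1) :
    P.map (fun ω => ∑ i, v i * X i ω) = gaussianReal 0 1 := by
  obtain ⟨σ, hσ⟩ := h v
  have := integral_map (μ := P) (φ := fun ω => ∑ i, v i * X i ω) (by fun_prop)
    (f := fun x : ℝ => x * x) (by fun_prop)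
  have hvar := variance_fun_id_gaussianReal (μ := 0) (v := σ)
  rw [variance_eq_integral measurable_id'.aemeasurable] at hvar
  simp only [integral_id_gaussianReal, sub_zero, pow_two] at hvar
  rw [hv, hσ, hvar] at this
  rw [hσ, show σ = 1 from by exact_mod_cast this]

lemma JointlyGaussianVec.indepFun_sum {m : ℕ} {X : Fin m → Ω → ℝ}
    (hX : ∀ i, Measurable (X i)) (h : JointlyGaussianVec P X) {k l : ℕ}
    (v : Fin k → Fin m → ℝ) (w : Fin l → Fin m → ℝ)
    (hvw : ∀ a b, ∫ ω, (∑ i, v a i * X i ω) * (∑ i, w b i * X i ω) ∂P = 0) :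
    IndepFun (fun ω a => ∑ i, v a i * X i ω) (fun ω b => ∑ i, w b i * X i ω) P := by
  have hG := h.hasGaussianLaw hX
  have := hG.isProbabilityMeasure
  have hL : ∀ u : Fin m → ℝ, MemLp (fun ω => ∑ i, u i * X i ω) 2 P := fun u =>
    memLp_finsetSum _ fun i _ => (h.memLp hX i).const_mul _
  refine HasGaussianLaw.indepFun_of_covariance_eval (X := fun a ω => ∑ i, v a i * X i ω)
    (Y := fun b ω => ∑ i, w b i * X i ω) ?_ fun a b => ?_
  · let comb : ∀ {n : ℕ}, (Fin n → Fin m → ℝ) → (Fin m → ℝ) →L[ℝ] (Fin n → ℝ) := fun u =>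
      ContinuousLinearMap.pi fun a => ∑ i, u a i • ContinuousLinearMap.proj (R := ℝ) i
    have := hG.map_fun ((comb v).prod (comb w))
    simpa [comb] using this
  · rw [covariance_eq_sub (hL _) (hL _), h.integral_sum hX, zero_mul, sub_zero]
    exact hvw a b

lemma JointlyGaussianVec.map_pair {m : ℕ} {X : Fin m → Ω → ℝ}
    (hX : ∀ i, Measurable (X i)) (h : JointlyGaussianVec P X) (i j : Fin m) :
    JointlyGaussianPair (P.map fun ω => (X i ω, X j ω)) := by
  intro a b
  obtain ⟨σ, hσ⟩ := h (Pi.single i a + Pi.single j b)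
  refine ⟨σ, ?_⟩
  rw [Measure.map_map (by fun_prop) (by fun_prop), ← hσ]
  congr 1
  ext ω
  simp [add_mul, Finset.sum_add_distrib, Pi.single_apply]

lemma Assumption31.abs_integral_mul_le {m : ℕ} {h : Fin m → ℝ → ℝ} {L : ℝ}
    (hh : Assumption31 h L) [IsProbabilityMeasure P] {X : Fin m → Ω → ℝ}
    (hX : ∀ i, Measurable (X i)) (hG : JointlyGaussianVec P X) {i j : Fin m} (hij : i ≠ j)
    (hi : ∫ ω, X i ω * X i ω ∂P = 1) (hj : ∫ ω, X j ω * X j ω ∂P = 1) :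
    |∫ ω, h i (X i ω) * h j (X j ω) ∂P| ≤ L * |∫ ω, X i ω * X j ω ∂P| := by
  obtain ⟨hc, -, -, -, -, hcov⟩ := hh
  have hm : Measurable fun ω => (X i ω, X j ω) := by fun_prop
  have hi' := (hc i).continuous
  have hj' := (hc j).continuous
  have := hcov i j hij (P.map fun ω => (X i ω, X j ω))
    (Measure.isProbabilityMeasure_map hm.aemeasurable) (hG.map_pair hX i j)
  rw [integral_map hm.aemeasurable (by fun_prop), integral_map hm.aemeasurable (by fun_prop),
    integral_map hm.aemeasurable (by fun_prop), integral_map hm.aemeasurable (by fun_prop)] at this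
  simp only [pow_two] at this
  exact this hi hj

lemma integrable_abs_pow_gaussianReal (n : ℕ) :
    Integrable (fun x : ℝ => |x| ^ n) (gaussianReal 0 1) := by
  have := (memLp_id_gaussianReal (μ := 0) (v := 1) n).integrable_norm_pow'
  simpa using this

lemma one_add_sum_pow_eight_le {x : Fin 5 → ℝ} (hx : ∀ i, 0 ≤ x i) :
    (1 + ∑ i, x i) ^ 8 ≤ 6 ^ 7 * (1 + ∑ i, x i ^ 8) := by
  have := pow_sum_div_card_le_sum_pow (s := Finset.univ) (f := (Fin.cons 1 x : Fin 6 → ℝ))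
    (fun i _ => Fin.cases zero_le_one hx i) 7
  rw [div_le_iff₀' (by simp)] at this
  simpa [Fin.sum_univ_succ (n := 5)] using this

lemma integrable_one_add_sum_pow_eight {Y : Fin 5 → Ω → ℝ} [IsProbabilityMeasure P]
    (hY : ∀ i, Measurable (Y i)) (hlaw : ∀ i, P.map (Y i) = gaussianReal 0 1) :
    Integrable (fun ω => (1 + ∑ i, |Y i ω|) ^ 8) P ∧
    ∫ ω, (1 + ∑ i, |Y i ω|) ^ 8 ∂P ≤
      6 ^ 7 * (1 + 5 * ∫ x, |x| ^ 8 ∂(gaussianReal 0 1)) := by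
  have hi : ∀ i, Integrable (fun ω => |Y i ω| ^ 8) P := fun i => by
    have := integrable_abs_pow_gaussianReal 8
    rw [← hlaw i, integrable_map_measure (by fun_prop) (by fun_prop)] at this
    exact this
  have hval : ∀ i, ∫ ω, |Y i ω| ^ 8 ∂P = ∫ x, |x| ^ 8 ∂(gaussianReal 0 1) := fun i => by
    rw [← hlaw i, integral_map (by fun_prop) (by fun_prop)]
  have hsum : Integrable (fun ω => ∑ i, |Y i ω| ^ 8) P := integrable_finsetSum _ fun i _ => hi i
  have hbd : Integrable (fun ω => 6 ^ 7 * (1 + ∑ i, |Y i ω| ^ 8)) P :=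
    ((integrable_const 1).add hsum).const_mul _
  have hle : ∀ ω, (1 + ∑ i, |Y i ω|) ^ 8 ≤ 6 ^ 7 * (1 + ∑ i, |Y i ω| ^ 8) := fun ω =>
    one_add_sum_pow_eight_le fun i => abs_nonneg _
  have hint : Integrable (fun ω => (1 + ∑ i, |Y i ω|) ^ 8) P := by
    refine hbd.mono' (by fun_prop) (ae_of_all _ fun ω => ?_)
    rw [Real.norm_eq_abs, abs_of_nonneg (by positivity)]
    exact hle ω
  refine ⟨hint, (integral_mono hint hbd hle).trans_eq ?_⟩
  rw [integral_const_mul, integral_add (integrable_const 1) hsum,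
    integral_finsetSum _ fun i _ => hi i]
  simp [hval]

/-- If `f₂ f₃` is close to a product `f₂' f₃'` independent of `g₀ g₁`, then
`E[g₀ g₁ f₂ f₃]` is close to `E[g₀ g₁] E[f₂ f₃]`. -/
lemma abs_integral_mul_le_of_indepFun [IsProbabilityMeasure P]
    {g₀ g₁ f₂ f₃ f₂' f₃' S : Ω → ℝ} {K ε A B : ℝ} (hK : 0 ≤ K) (hε : 0 ≤ ε)
    (mg₀ : Measurable g₀) (mg₁ : Measurable g₁) (mf₂ : Measurable f₂) (mf₃ : Measurable f₃)
    (mf₂' : Measurable f₂') (mf₃' : Measurable f₃')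
    (hS : ∀ ω, 1 ≤ S ω) (hSi : Integrable (fun ω => S ω ^ 8) P)
    (hg₀ : ∀ ω, |g₀ ω| ≤ K * S ω ^ 2) (hg₁ : ∀ ω, |g₁ ω| ≤ K * S ω ^ 2)
    (hf₂ : ∀ ω, |f₂ ω| ≤ K * S ω ^ 2) (hf₃ : ∀ ω, |f₃ ω| ≤ K * S ω ^ 2)
    (hf₂' : ∀ ω, |f₂' ω| ≤ K * S ω ^ 2) (hf₃' : ∀ ω, |f₃' ω| ≤ K * S ω ^ 2)
    (hd₂ : ∀ ω, |f₂ ω - f₂' ω| ≤ K * ε * S ω ^ 2)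
    (hd₃ : ∀ ω, |f₃ ω - f₃' ω| ≤ K * ε * S ω ^ 2)
    (hind : IndepFun (fun ω => g₀ ω * g₁ ω) (fun ω => f₂' ω * f₃' ω) P)
    (hA : |∫ ω, g₀ ω * g₁ ω ∂P| ≤ A) (hB : |∫ ω, f₂ ω * f₃ ω ∂P| ≤ B) :
    |∫ ω, g₀ ω * g₁ ω * (f₂ ω * f₃ ω) ∂P| ≤
      2 * K ^ 4 * ε * ∫ ω, S ω ^ 8 ∂P + A * (2 * K ^ 2 * ε * ∫ ω, S ω ^ 8 ∂P + B) := by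
  have hS48 : ∀ ω, S ω ^ 4 ≤ S ω ^ 8 := fun ω => pow_le_pow_right₀ (hS ω) (by norm_num)
  have hS0 : ∀ ω, 0 ≤ S ω := fun ω => zero_le_one.trans (hS ω)
  have mul_bd : ∀ {x y a b s : ℝ}, |x| ≤ a * s ^ 2 → |y| ≤ b * s ^ 2 →
      |x * y| ≤ a * b * s ^ 4 := fun {x y a b s} hx hy => by
    rw [abs_mul]
    calc |x| * |y| ≤ (a * s ^ 2) * (b * s ^ 2) :=
          mul_le_mul hx hy (abs_nonneg _) ((abs_nonneg _).trans hx)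
      _ = a * b * s ^ 4 := by ring
  have mul_bd' : ∀ {x y a b s : ℝ}, |x| ≤ a * s ^ 4 → |y| ≤ b * s ^ 4 →
      |x * y| ≤ a * b * s ^ 8 := fun {x y a b s} hx hy => by
    rw [abs_mul]
    calc |x| * |y| ≤ (a * s ^ 4) * (b * s ^ 4) :=
          mul_le_mul hx hy (abs_nonneg _) ((abs_nonneg _).trans hx)
      _ = a * b * s ^ 8 := by ring
  have int_bd : ∀ {u : Ω → ℝ} {c : ℝ}, Measurable u → (∀ ω, |u ω| ≤ c * S ω ^ 8) →
      Integrable u P ∧ |∫ ω, u ω ∂P| ≤ c * ∫ ω, S ω ^ 8 ∂P := fun {u c} hu hb =>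
    ⟨(hSi.const_mul c).mono' hu.aestronglyMeasurable (ae_of_all _ hb), by
      rw [← integral_const_mul]
      exact norm_integral_le_of_norm_le (f := u) (hSi.const_mul c) (ae_of_all _ hb)⟩
  have up : ∀ {x c : ℝ} {ω}, 0 ≤ c → |x| ≤ c * S ω ^ 4 → |x| ≤ c * S ω ^ 8 :=
    fun hc h => h.trans (mul_le_mul_of_nonneg_left (hS48 _) hc)
  have hG : ∀ ω, |g₀ ω * g₁ ω| ≤ K * K * S ω ^ 4 := fun ω => mul_bd (hg₀ ω) (hg₁ ω)
  have hF : ∀ ω, |f₂ ω * f₃ ω| ≤ K * K * S ω ^ 4 := fun ω => mul_bd (hf₂ ω) (hf₃ ω)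
  have hF' : ∀ ω, |f₂' ω * f₃' ω| ≤ K * K * S ω ^ 4 := fun ω => mul_bd (hf₂' ω) (hf₃' ω)
  have hD : ∀ ω, |f₂ ω * f₃ ω - f₂' ω * f₃' ω| ≤ 2 * K ^ 2 * ε * S ω ^ 4 := fun ω => by
    have h1 := mul_bd (hd₂ ω) (hf₃ ω)
    have h2 := mul_bd (hf₂' ω) (hd₃ ω)
    have h3 : f₂ ω * f₃ ω - f₂' ω * f₃' ω =
      (f₂ ω - f₂' ω) * f₃ ω + f₂' ω * (f₃ ω - f₃' ω) := by ring
    rw [h3]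
    refine (abs_add_le _ _).trans ((add_le_add h1 h2).trans_eq (by ring))
  have hKK : 0 ≤ K * K := mul_nonneg hK hK
  have hKε : 0 ≤ 2 * K ^ 2 * ε := by positivity
  have iG := (int_bd (by fun_prop) fun ω => up hKK (hG ω)).1
  have iF := (int_bd (by fun_prop) fun ω => up hKK (hF ω)).1
  have iF' := (int_bd (by fun_prop) fun ω => up hKK (hF' ω)).1
  have iGF := (int_bd (by fun_prop) fun ω => mul_bd' (hG ω) (hF ω)).1
  have iGF' := (int_bd (by fun_prop) fun ω => mul_bd' (hG ω) (hF' ω)).1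
  have bD := (int_bd (by fun_prop) fun ω => up hKε (hD ω)).2
  have bGD := (int_bd (by fun_prop) fun ω => mul_bd' (hG ω) (hD ω)).2
  rw [integral_sub iF iF'] at bD
  simp only [mul_sub] at bGD
  rw [integral_sub iGF iGF', hind.integral_fun_mul_eq_mul_integral iG.1 iF'.1] at bGD
  have bF' : |∫ ω, f₂' ω * f₃' ω ∂P| ≤ 2 * K ^ 2 * ε * ∫ ω, S ω ^ 8 ∂P + B := by
    rw [abs_le] at *
    constructor <;> linarith [bD.1, bD.2, hB.1, hB.2]
  have hprod := mul_le_mul hA bF' (abs_nonneg _) ((abs_nonneg _).trans hA)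
  rw [← abs_mul] at hprod
  rw [show K * K * (2 * K ^ 2 * ε) = 2 * K ^ 4 * ε by ring] at bGD
  have := abs_add_le (∫ ω, g₀ ω * g₁ ω * (f₂ ω * f₃ ω) ∂P -
    (∫ ω, g₀ ω * g₁ ω ∂P) * ∫ ω, f₂' ω * f₃' ω ∂P)
    ((∫ ω, g₀ ω * g₁ ω ∂P) * ∫ ω, f₂' ω * f₃' ω ∂P)
  rw [sub_add_cancel] at this
  linarith

/-- Conditioning on the first two coordinates, in the form of an explicit residual:
if `X j - a j X₀ - b j W`, `j = 2, 3`, are independent of `(X₀, X₁)` with `a j, b j` small, then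
`E[h₀(X₀) h₁(X₁) h₂(X₂) h₃(X₃)]` is close to `E[h₀(X₀) h₁(X₁)] E[h₂(X₂) h₃(X₃)]`. -/
lemma abs_integral_prod_le_of_residual [IsProbabilityMeasure P] {h : Fin 4 → ℝ → ℝ}
    {K ε A B : ℝ} (hK : 0 ≤ K) (hε : 0 ≤ ε) (hdiff : ∀ j, Differentiable ℝ (h j))
    (hv0 : ∀ j, |h j 0| ≤ K) (hd0 : ∀ j, |deriv (h j) 0| ≤ K)
    (hlip : ∀ j x y, |deriv (h j) x - deriv (h j) y| ≤ K * |x - y|)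
    {X R : Fin 4 → Ω → ℝ} {W : Ω → ℝ} (hX : ∀ i, Measurable (X i)) (hW : Measurable W)
    (hXlaw : ∀ i, P.map (X i) = gaussianReal 0 1) (hWlaw : P.map W = gaussianReal 0 1)
    {a b : Fin 4 → ℝ} (hR : ∀ j ω, R j ω = X j ω - a j * X 0 ω - b j * W ω)
    (ha1 : ∀ j, |a j| ≤ 1) (hb1 : ∀ j, |b j| ≤ 1)
    (hae : ∀ j, j = 2 ∨ j = 3 → |a j| ≤ ε) (hbe : ∀ j, j = 2 ∨ j = 3 → |b j| ≤ ε)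
    (hind : IndepFun (fun ω => h 0 (X 0 ω) * h 1 (X 1 ω))
      (fun ω => h 2 (R 2 ω) * h 3 (R 3 ω)) P)
    (hA : |∫ ω, h 0 (X 0 ω) * h 1 (X 1 ω) ∂P| ≤ A)
    (hB : |∫ ω, h 2 (X 2 ω) * h 3 (X 3 ω) ∂P| ≤ B) :
    |∫ ω, h 0 (X 0 ω) * h 1 (X 1 ω) * h 2 (X 2 ω) * h 3 (X 3 ω) ∂P| ≤
      2 * K ^ 4 * ε * (6 ^ 7 * (1 + 5 * ∫ x, |x| ^ 8 ∂(gaussianReal 0 1))) +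
        A * (2 * K ^ 2 * ε * (6 ^ 7 * (1 + 5 * ∫ x, |x| ^ 8 ∂(gaussianReal 0 1))) + B) := by
  have hmh : ∀ j, Measurable (h j) := fun j => (hdiff j).continuous.measurable
  have hRm : ∀ j, Measurable (R j) := fun j => by
    rw [funext (hR j)]; fun_prop
  let Y : Fin 5 → Ω → ℝ := Fin.cons W X
  have hYm : ∀ i, Measurable (Y i) := Fin.cases hW hX
  obtain ⟨hSi, hSb⟩ := integrable_one_add_sum_pow_eight hYm
    (Fin.cases hWlaw hXlaw)
  set M := 6 ^ 7 * (1 + 5 * ∫ x, |x| ^ 8 ∂(gaussianReal 0 1))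
  have hT : ∀ ω, ∑ i, |Y i ω| = |X 0 ω| + |X 1 ω| + |X 2 ω| + |X 3 ω| + |W ω| := fun ω => by
    simp [Fin.sum_univ_succ (n := 4), Y, Fin.sum_univ_four, add_comm]
  obtain ⟨T, hTY⟩ : ∃ T : Ω → ℝ, ∀ ω, ∑ i, |Y i ω| = T ω := ⟨_, fun _ => rfl⟩
  simp only [hTY] at hT hSi hSb
  have hTX : ∀ i ω, |X i ω| ≤ T ω := fun i ω => by
    rw [hT]
    have := abs_nonneg (W ω)
    have := fun i => abs_nonneg (X i ω)
    fin_cases i <;> simp <;> linarith [this 0, this 1, this 2, this 3]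
  have hT0W : ∀ ω, |X 0 ω| + |W ω| ≤ T ω := fun ω => by
    rw [hT]
    have := fun i => abs_nonneg (X i ω)
    linarith [this 1, this 2, this 3]
  have hmul1 : ∀ {x z : ℝ}, |x| ≤ 1 → |x * z| ≤ |z| := fun {x z} hx => by
    rw [abs_mul]; exact mul_le_of_le_one_left (abs_nonneg _) hx
  have hTR : ∀ j, j = 2 ∨ j = 3 → ∀ ω, |R j ω| ≤ T ω := fun j hj ω => by
    rw [hR, hT]
    have h1 := abs_sub (X j ω - a j * X 0 ω) (b j * W ω)
    have h2 := abs_sub (X j ω) (a j * X 0 ω)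
    have h3 := hmul1 (z := X 0 ω) (ha1 j)
    have h4 := hmul1 (z := W ω) (hb1 j)
    have := fun i => abs_nonneg (X i ω)
    rcases hj with rfl | rfl <;> linarith [this 1, this 2, this 3]
  have hXRε : ∀ j, j = 2 ∨ j = 3 → ∀ ω, |X j ω - R j ω| ≤ ε * (1 + T ω) :=
    fun j hj ω => by
    have h1 := abs_add_le (a j * X 0 ω) (b j * W ω)
    rw [abs_mul, abs_mul] at h1
    have h2 := mul_le_mul_of_nonneg_right (hae j hj) (abs_nonneg (X 0 ω))
    have h3 := mul_le_mul_of_nonneg_right (hbe j hj) (abs_nonneg (W ω))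
    have h4 := mul_le_mul_of_nonneg_left (hT0W ω) hε
    rw [hR, show X j ω - (X j ω - a j * X 0 ω - b j * W ω) = a j * X 0 ω + b j * W ω by ring]
    linarith
  have hbd : ∀ j {x : ℝ} {ω}, |x| ≤ T ω → |h j x| ≤ K * (1 + T ω) ^ 2 :=
    fun j _ _ hx => abs_le_of_lipschitz_deriv (hdiff j) (hv0 j) (hd0 j) (hlip j) hx
  have hdd : ∀ j, j = 2 ∨ j = 3 → ∀ ω,
      |h j (X j ω) - h j (R j ω)| ≤ K * ε * (1 + T ω) ^ 2 := fun j hj ω => by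
    have h1 := abs_sub_le_of_lipschitz_deriv (hdiff j) (hd0 j) (hlip j) (hTX j ω) (hTR j hj ω)
    have h0 : 0 ≤ T ω := (abs_nonneg _).trans (hTX 0 ω)
    have h2 := mul_le_mul_of_nonneg_left (hXRε j hj ω)
      (mul_nonneg hK (by linarith : 0 ≤ 1 + T ω))
    exact (h1.trans h2).trans_eq (by ring)
  have main := abs_integral_mul_le_of_indepFun (g₀ := fun ω => h 0 (X 0 ω))
    (g₁ := fun ω => h 1 (X 1 ω)) (f₂ := fun ω => h 2 (X 2 ω)) (f₃ := fun ω => h 3 (X 3 ω))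
    (f₂' := fun ω => h 2 (R 2 ω)) (f₃' := fun ω => h 3 (R 3 ω)) hK hε
    (by fun_prop) (by fun_prop) (by fun_prop) (by fun_prop) (by fun_prop) (by fun_prop)
    (fun ω => le_add_of_nonneg_right ((abs_nonneg _).trans (hTX 0 ω))) hSi
    (fun ω => hbd 0 (hTX 0 ω)) (fun ω => hbd 1 (hTX 1 ω)) (fun ω => hbd 2 (hTX 2 ω))
    (fun ω => hbd 3 (hTX 3 ω)) (fun ω => hbd 2 (hTR 2 (.inl rfl) ω))
    (fun ω => hbd 3 (hTR 3 (.inr rfl) ω)) (hdd 2 (.inl rfl)) (hdd 3 (.inr rfl)) hind hA hB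
  simp only [← mul_assoc (h 0 _ * h 1 _)] at main
  refine main.trans ?_
  have hA0 : 0 ≤ A := (abs_nonneg _).trans hA
  gcongr

/-- Regression of the coordinates on the first two, in terms of the orthonormal pair `X 0, W`
obtained from `X 0, X 1` by Gram-Schmidt. -/
lemma JointlyGaussianVec.exists_residual {X : Fin 4 → Ω → ℝ}
    (hX : ∀ i, Measurable (X i)) (hG : JointlyGaussianVec P X) {ρ : Fin 4 → Fin 4 → ℝ}
    (hρ : ∀ i j, ρ i j = ∫ ω, X i ω * X j ω ∂P) (hdiag : ∀ i, ρ i i = 1) {s : ℝ}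
    (hs : s ≠ 0) (hs2 : s ^ 2 = 1 - ρ 0 1 ^ 2) :
    ∃ (W : Ω → ℝ) (R : Fin 4 → Ω → ℝ) (b : Fin 4 → ℝ), Measurable W ∧
      P.map W = gaussianReal 0 1 ∧ (∀ j ω, R j ω = X j ω - ρ 0 j * X 0 ω - b j * W ω) ∧
      (∀ j, b j = (ρ 1 j - ρ 0 1 * ρ 0 j) / s) ∧ (∀ j, ρ 0 j ^ 2 + b j ^ 2 ≤ 1) ∧
      IndepFun (fun ω => (X 0 ω, X 1 ω)) (fun ω j => R j ω) P := by
  have hsymm : ∀ i j, ρ i j = ρ j i := fun i j => by simp_rw [hρ, mul_comm]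
  have hQ : ∀ v w : Fin 4 → ℝ, ∫ ω, (∑ i, v i * X i ω) * (∑ i, w i * X i ω) ∂P =
      ∑ i, ∑ j, v i * w j * ρ i j := fun v w => by
    simp_rw [hG.integral_sum_mul_sum hX, hρ]
  have hb : ∀ j, ρ 1 j = (ρ 1 j - ρ 0 1 * ρ 0 j) / s * s + ρ 0 1 * ρ 0 j := fun j => by
    rw [div_mul_cancel₀ _ hs]; ring
  obtain ⟨b, hbdef⟩ : ∃ b : Fin 4 → ℝ, ∀ j, b j = (ρ 1 j - ρ 0 1 * ρ 0 j) / s :=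
    ⟨_, fun _ => rfl⟩
  simp only [← hbdef] at hb
  let w : Fin 4 → ℝ := Pi.single 0 (-(ρ 0 1 / s)) + Pi.single 1 s⁻¹
  let u : Fin 4 → Fin 4 → ℝ := fun j => residualCoeff ρ s (b j) j
  refine ⟨fun ω => ∑ i, w i * X i ω, fun j ω => ∑ i, u j i * X i ω, b, by fun_prop,
    hG.map_sum_eq_gaussianReal hX w ?_, fun j ω => ?_, hbdef, fun j => ?_, ?_⟩
  · rw [hQ]
    simp [w, Fin.sum_univ_four, hdiag, hsymm 1 0]
    field_simp
    linear_combination -hs2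
  · simp [u, w, residualCoeff, Pi.single_apply, add_mul, Finset.sum_add_distrib]
    ring
  · have : 0 ≤ ∫ ω, (∑ i, u j i * X i ω) * (∑ i, u j i * X i ω) ∂P :=
      integral_nonneg fun ω => mul_self_nonneg _
    rw [hQ, sum_residualCoeff_mul_residualCoeff hsymm hdiag hs hs2 (hb j)] at this
    linarith
  · have h0 : ∀ j, ∑ i, ∑ k, (Pi.single 0 1 : Fin 4 → ℝ) i * u j k * ρ i k = 0 := fun j => by
      rw [sum_single_mul_residualCoeff, hdiag]
      ring
    have h1 : ∀ j, ∑ i, ∑ k, (Pi.single 1 1 : Fin 4 → ℝ) i * u j k * ρ i k = 0 := fun j => by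
      rw [sum_single_mul_residualCoeff, hdiag, hsymm 1 0, hb]
      field_simp
      linear_combination b j * hs2
    have := hG.indepFun_sum hX ![Pi.single 0 1, Pi.single 1 1] u (fun a c => by
      rw [hQ]; fin_cases a
      exacts [h0 c, h1 c])
    have := this.comp (φ := fun x => (x 0, x 1)) (ψ := id) (by fun_prop) measurable_id
    simpa [Function.comp_def, Pi.single_apply] using this

end Gaussian


/-- Lemma 3.3, inequality (3.6): for every `L ≥ 0` there is a constant `C`,
depending only on `L`, bounding `|E[∏ h_j(X_j)]|` by
`C(|ρ₁₂ρ₃₄| + (1 − ρ₁₂²)^{-1/2} max_{i ≤ 2 < j} |ρ_{ij}|)` when `|ρ₁₂| < 1`. -/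
theorem product_bound_rho12 (L : ℝ) (hL : 0 ≤ L) :
    ∃ C : ℝ, ∀ (h : Fin 4 → ℝ → ℝ), Assumption31 h L →
      ∀ (Ω : Type) [MeasurableSpace Ω] (P : Measure Ω), IsProbabilityMeasure P →
      ∀ X : Fin 4 → Ω → ℝ, (∀ i, Measurable (X i)) →
      JointlyGaussianVec P X →
      ∀ ρ : Fin 4 → Fin 4 → ℝ,
      (∀ i j, ρ i j = ∫ ω, X i ω * X j ω ∂P) →
      (∀ i, ρ i i = 1) →
      |ρ 0 1| < 1 →
      |∫ ω, h 0 (X 0 ω) * h 1 (X 1 ω) * h 2 (X 2 ω) * h 3 (X 3 ω) ∂P| ≤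
        C * (|ρ 0 1 * ρ 2 3| +
          (Real.sqrt (1 - ρ 0 1 ^ 2))⁻¹ *
            max (max |ρ 0 2| |ρ 0 3|) (max |ρ 1 2| |ρ 1 3|)) := by
  refine ⟨L ^ 2 + 8 * L ^ 2 * (6 ^ 7 * (1 + 5 * ∫ x, |x| ^ 8 ∂(gaussianReal 0 1))), ?_⟩
  intro h hh Ω _ P _ X hX hG ρ hρ hdiag hlt
  obtain ⟨K, hK, hKL⟩ : ∃ K : ℝ, 0 ≤ K ∧ K ^ 2 = L :=
    ⟨√L, Real.sqrt_nonneg _, Real.sq_sqrt hL⟩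
  obtain ⟨hc, hv0, hd0, hlip, -, -⟩ := id hh
  have hdiff : ∀ j, Differentiable ℝ (h j) := fun j => (hc j).differentiable (by norm_num)
  have hmh : ∀ j, Measurable (h j) := fun j => (hc j).continuous.measurable
  have hv0' : ∀ j, |h j 0| ≤ K := fun j => abs_le_of_sq_le_sq (hKL ▸ hv0 j) hK
  have hd0' : ∀ j, |deriv (h j) 0| ≤ K := fun j => abs_le_of_sq_le_sq (hKL ▸ hd0 j) hK
  have hlip' : ∀ j x y, |deriv (h j) x - deriv (h j) y| ≤ K * |x - y| := fun j x y => by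
    obtain ⟨l, hl, hxy⟩ := hlip j
    exact (hxy x y).trans (mul_le_mul_of_nonneg_right
      ((le_abs_self l).trans (abs_le_of_sq_le_sq (hKL ▸ hl) hK)) (abs_nonneg _))
  have hr2 : ρ 0 1 ^ 2 < 1 := (sq_lt_one_iff_abs_lt_one _).2 hlt
  have hs : 0 < √(1 - ρ 0 1 ^ 2) := Real.sqrt_pos.2 (by linarith)
  have hs2 : √(1 - ρ 0 1 ^ 2) ^ 2 = 1 - ρ 0 1 ^ 2 := Real.sq_sqrt (by linarith)
  have hρmx : ∀ j, j = 2 ∨ j = 3 →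
      |ρ 0 j| ≤ max (max |ρ 0 2| |ρ 0 3|) (max |ρ 1 2| |ρ 1 3|) ∧
      |ρ 1 j| ≤ max (max |ρ 0 2| |ρ 0 3|) (max |ρ 1 2| |ρ 1 3|) := by
    rintro j (rfl | rfl) <;> simp
  generalize √(1 - ρ 0 1 ^ 2) = s at hs hs2 ⊢
  generalize max (max |ρ 0 2| |ρ 0 3|) (max |ρ 1 2| |ρ 1 3|) = mx at hρmx ⊢
  obtain ⟨W, R, b, hW, hWlaw, hR, hb, hab, hind⟩ := hG.exists_residual hX hρ hdiag hs.ne' hs2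
  have hmx0 : 0 ≤ mx := (abs_nonneg _).trans (hρmx 2 (.inl rfl)).1
  have hsinv : 1 ≤ s⁻¹ := (one_le_inv₀ hs).2 (by nlinarith [sq_nonneg (ρ 0 1)])
  have ha1 : ∀ j, |ρ 0 j| ≤ 1 := fun j => by
    rw [← sq_le_one_iff_abs_le_one]; nlinarith [hab j, sq_nonneg (b j)]
  have hb1 : ∀ j, |b j| ≤ 1 := fun j => by
    rw [← sq_le_one_iff_abs_le_one]; nlinarith [hab j, sq_nonneg (ρ 0 j)]
  have hq : 0 ≤ s⁻¹ * mx := by positivity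
  have hae : ∀ j, j = 2 ∨ j = 3 → |ρ 0 j| ≤ 2 * (s⁻¹ * mx) := fun j hj => by
    nlinarith [(hρmx j hj).1, mul_le_mul_of_nonneg_right hsinv hmx0]
  have hbe : ∀ j, j = 2 ∨ j = 3 → |b j| ≤ 2 * (s⁻¹ * mx) := fun j hj => by
    have h1 := abs_sub (ρ 1 j) (ρ 0 1 * ρ 0 j)
    have h2 := mul_le_of_le_one_left (abs_nonneg (ρ 0 j)) hlt.le
    rw [abs_mul] at h1
    obtain ⟨h3, h4⟩ := hρmx j hj
    rw [hb, abs_div, abs_of_pos hs, div_eq_inv_mul, mul_left_comm]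
    exact mul_le_mul_of_nonneg_left (by linarith) (by positivity)
  have hind' := hind.comp (φ := fun x => h 0 x.1 * h 1 x.2)
    (ψ := fun x => h 2 (x 2) * h 3 (x 3)) (by fun_prop) (by fun_prop)
  have hX1 : ∀ i, ∫ ω, X i ω * X i ω ∂P = 1 := fun i => by rw [← hρ, hdiag]
  have hXlaw : ∀ i, P.map (X i) = gaussianReal 0 1 := fun i => by
    have := hG.map_sum_eq_gaussianReal hX (Pi.single i 1)
    simp only [Pi.single_apply, ite_mul, one_mul, zero_mul, Finset.sum_ite_eq',
      Finset.mem_univ, if_true] at this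
    exact this (hX1 i)
  have hA := hh.abs_integral_mul_le hX hG (by decide : (0 : Fin 4) ≠ 1) (hX1 0) (hX1 1)
  have hB := hh.abs_integral_mul_le hX hG (by decide : (2 : Fin 4) ≠ 3) (hX1 2) (hX1 3)
  rw [← hρ] at hA hB
  refine (abs_integral_prod_le_of_residual hK (by positivity) hdiff hv0' hd0' hlip' hX hW
    hXlaw hWlaw hR ha1 hb1 hae hbe hind' hA hB).trans ?_
  have hM : 0 ≤ ∫ x, |x| ^ 8 ∂(gaussianReal 0 1) := integral_nonneg fun x => by positivity
  generalize ∫ x, |x| ^ 8 ∂(gaussianReal 0 1) = I at hM ⊢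
  generalize s⁻¹ * mx = q at hq ⊢
  obtain ⟨M, hMdef⟩ : ∃ M, M = 6 ^ 7 * (1 + 5 * I) := ⟨_, rfl⟩
  have hM0 : 0 ≤ M := by rw [hMdef]; positivity
  rw [← hMdef, show K ^ 4 = L ^ 2 by rw [← hKL]; ring, hKL, abs_mul]
  have h1 : L ^ 2 * q * M * |ρ 0 1| ≤ L ^ 2 * q * M :=
    mul_le_of_le_one_right (by positivity) hlt.le
  have h2 : 0 ≤ L ^ 2 * M * (|ρ 0 1| * |ρ 2 3|) := by positivity
  have h3 : 0 ≤ L ^ 2 * q := by positivity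
  linarith
end

section
/- Let p(t, x) = (2πt)^{-1/2} exp(−x²/(2t)) for t > 0, x ∈ ℝ be the one-dimensional heat kernel. For all real numbers 0 ≤ s ≤ t and every x ∈ ℝ, ∫_0^s ∫_ℝ p(t − r, x − y) · p(s − r, x − y) dy dr = (2π)^{-1/2} ( √(t + s) − √(t − s) ). (This computes the covariance E[u(s,x)u(t,x)] of the solution of the stochastic heat equation at a fixed spatial point.) -/
open MeasureTheory Real

/-- The one-dimensional heat kernel `p(t,x) = (2πt)^{-1/2} e^{-x²/(2t)}`. -/
noncomputable def heatKernel (t x : ℝ) : ℝ :=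
  (Real.sqrt (2 * Real.pi * t))⁻¹ * Real.exp (-x ^ 2 / (2 * t))

/-- The `L²` pairing of two heat kernels with the same centre is `p(a + b, 0) = (2π(a + b))^{-1/2}`. -/
theorem integral_heatKernel_mul_heatKernel {a b : ℝ} (ha : 0 < a) (hb : 0 < b) (x : ℝ) :
    ∫ y : ℝ, heatKernel a (x - y) * heatKernel b (x - y) =
      (Real.sqrt (2 * Real.pi))⁻¹ * (Real.sqrt (a + b))⁻¹ := by
  rw [integral_sub_left_eq_self (fun z => heatKernel a z * heatKernel b z) volume x]
  have hπ := Real.pi_pos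
  have hmul (z : ℝ) : heatKernel a z * heatKernel b z =
      ((√(2 * π * a))⁻¹ * (√(2 * π * b))⁻¹) * exp (-((a + b) / (2 * a * b)) * z ^ 2) := by
    rw [heatKernel, heatKernel, mul_mul_mul_comm, ← exp_add]
    congr 2
    field_simp
    ring
  simp_rw [hmul]
  rw [integral_const_mul, integral_gaussian, ← sqrt_inv, ← sqrt_inv, ← sqrt_inv, ← sqrt_inv,
    ← sqrt_mul (by positivity), ← sqrt_mul (by positivity), ← sqrt_mul (by positivity)]
  congr 1
  field_simp

/-- The covariance computation for the stochastic heat equation at a fixed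
spatial point: `∫_0^s ∫_ℝ p(t−r, x−y)p(s−r, x−y) dy dr
= (2π)^{-1/2}(√(t+s) − √(t−s))` for `0 ≤ s ≤ t`. -/
theorem heat_kernel_covariance (s t x : ℝ) (hs : 0 ≤ s) (hst : s ≤ t) :
    ∫ r in Set.Ioo (0 : ℝ) s, ∫ y : ℝ,
        heatKernel (t - r) (x - y) * heatKernel (s - r) (x - y) =
      (Real.sqrt (2 * Real.pi))⁻¹ * (Real.sqrt (t + s) - Real.sqrt (t - s)) := by
  have hinner : ∀ r ∈ Set.Ioo (0 : ℝ) s,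
      ∫ y : ℝ, heatKernel (t - r) (x - y) * heatKernel (s - r) (x - y) =
        (√(2 * π))⁻¹ * (√(t + s - 2 * r))⁻¹ := fun r hr => by
    rw [integral_heatKernel_mul_heatKernel (by linarith [hr.2]) (by linarith [hr.2])]
    ring_nf
  rw [setIntegral_congr_fun measurableSet_Ioo hinner, integral_const_mul,
    ← integral_Ioc_eq_integral_Ioo, ← intervalIntegral.integral_of_le hs]
  have hcont : ContinuousOn (fun r : ℝ => -√(t + s - 2 * r)) (Set.Icc 0 s) := by fun_prop
  have hderiv : ∀ r ∈ Set.Ioo (0 : ℝ) s,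
      HasDerivAt (fun r : ℝ => -√(t + s - 2 * r)) (√(t + s - 2 * r))⁻¹ r := fun r hr => by
    have hpos : 0 < t + s - 2 * r := by linarith [hr.2]
    have hlin : HasDerivAt (fun r : ℝ => t + s - 2 * r) (-(2 * 1)) r :=
      ((hasDerivAt_id r).const_mul 2).const_sub (t + s)
    refine (hlin.sqrt hpos.ne').neg.congr_deriv ?_
    field_simp
  have hint : IntervalIntegrable (fun r : ℝ => (√(t + s - 2 * r))⁻¹) volume 0 s := by
    rw [intervalIntegrable_iff_integrableOn_Ioc_of_le hs]
    exact intervalIntegral.integrableOn_deriv_of_nonneg hcont hderiv fun r _ => by positivity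
  rw [intervalIntegral.integral_eq_sub_of_hasDerivAt_of_le hs hcont hderiv hint]
  ring_nf
end

section
/- Let F be the centered Gaussian process with covariance E[F(s)F(t)] = (2π)^{-1/2}(√(t+s) − √|t−s|). Then for all 0 ≤ s < t, E|F(t) − F(s)|² = (1/√π)(√t + √s − √(2t + 2s) + √(2t − 2s)), and | E|F(t) − F(s)|² − √(2(t − s)/π) | ≤ |t − s|² / t^{3/2}. -/
open MeasureTheory ProbabilityTheory Filter

/-- The second moment of a centered Gaussian is its variance. -/
theorem integral_sq_gaussianReal_zero (v : NNReal) :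
    ∫ x, x ^ 2 ∂(gaussianReal 0 v) = v := by
  have h := variance_fun_id_gaussianReal (μ := 0) (v := v)
  rwa [variance_of_integral_eq_zero (by fun_prop) integral_id_gaussianReal] at h

/-- The second moment of an increment in terms of the covariance function. -/
theorem IsHeatGaussian.integral_sq_sub {Ω : Type*} [MeasurableSpace Ω]
    {P : Measure Ω} {F : ℝ → Ω → ℝ} (hF : IsHeatGaussian P F)
    {s t : ℝ} (hs : 0 ≤ s) (ht : 0 ≤ t) :
    ∫ ω, (F t ω - F s ω) ^ 2 ∂P =
      max (covK t t - covK t s - covK s t + covK s s) 0 := by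
  obtain ⟨-, hm, hg⟩ := hF
  have h := hg 2 ![t, s] ![1, -1] (by simp [Fin.forall_fin_two, hs, ht])
  have hsum : (fun ω => ∑ i : Fin 2, (![1, -1] : Fin 2 → ℝ) i * F ((![t, s] : Fin 2 → ℝ) i) ω) =
      fun ω => F t ω - F s ω := by
    funext ω
    simp [Fin.sum_univ_two]
    ring
  have hvar : (∑ i : Fin 2, ∑ j : Fin 2, (![1, -1] : Fin 2 → ℝ) i * (![1, -1] : Fin 2 → ℝ) j *
      covK ((![t, s] : Fin 2 → ℝ) i) ((![t, s] : Fin 2 → ℝ) j)) =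
      covK t t - covK t s - covK s t + covK s s := by
    simp [Fin.sum_univ_two]
    ring
  rw [hsum, hvar] at h
  have hmeas : Measurable fun ω => F t ω - F s ω := (hm t).sub (hm s)
  rw [← integral_map (f := fun x : ℝ => x ^ 2) hmeas.aemeasurable (by fun_prop), h,
    integral_sq_gaussianReal_zero, Real.coe_toNNReal']

theorem covK_increment {s t : ℝ} (hst : s < t) :
    covK t t - covK t s - covK s t + covK s s =
      (Real.sqrt Real.pi)⁻¹ *
        (Real.sqrt t + Real.sqrt s - Real.sqrt (2 * t + 2 * s) +
          Real.sqrt (2 * t - 2 * s)) := by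
  have h2 : Real.sqrt 2 ≠ 0 := by positivity
  have hsq : Real.sqrt 2 ^ 2 = 2 := Real.sq_sqrt (by norm_num)
  have hpi : Real.sqrt Real.pi ≠ 0 := (Real.sqrt_pos.2 Real.pi_pos).ne'
  have habs : |s - t| = t - s := by rw [abs_sub_comm, abs_of_pos (sub_pos.2 hst)]
  simp only [covK, sub_self, abs_zero, Real.sqrt_zero, habs, abs_of_pos (sub_pos.2 hst),
    ← two_mul, ← mul_add, ← mul_sub, add_comm s t,
    Real.sqrt_mul (zero_le_two : (0 : ℝ) ≤ 2)]
  field_simp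
  linear_combination (Real.sqrt (t + s) - Real.sqrt (t - s)) * hsq

theorem sqrt_add_sqrt_bounds {s t : ℝ} (hs : 0 ≤ s) (hst : s < t) :
    Real.sqrt (2 * t + 2 * s) ≤ Real.sqrt t + Real.sqrt s + Real.sqrt (2 * t - 2 * s) ∧
    Real.sqrt t + Real.sqrt s ≤ Real.sqrt (2 * t + 2 * s) ∧
    Real.sqrt (2 * t + 2 * s) - (Real.sqrt t + Real.sqrt s) ≤
      (t - s) ^ 2 / t ^ ((3 : ℝ) / 2) := by
  have ht : 0 < t := hs.trans_lt hst
  have hpow : t ^ ((3 : ℝ) / 2) = Real.sqrt t ^ 3 := by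
    rw [Real.sqrt_eq_rpow, ← Real.rpow_natCast, ← Real.rpow_mul ht.le]
    norm_num
  have ha : 0 < Real.sqrt t := Real.sqrt_pos.2 ht
  have hb := Real.sqrt_nonneg s
  have hab : Real.sqrt s ≤ Real.sqrt t := Real.sqrt_le_sqrt hst.le
  have ha2 := Real.sq_sqrt ht.le
  have hb2 := Real.sq_sqrt hs
  have hc := Real.sqrt_nonneg (2 * t + 2 * s)
  have hc2 := Real.sq_sqrt (show 0 ≤ 2 * t + 2 * s by linarith)
  have hd := Real.sqrt_nonneg (2 * t - 2 * s)
  have hd2 := Real.sq_sqrt (show 0 ≤ 2 * t - 2 * s by linarith)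
  rw [hpow]
  set a := Real.sqrt t
  set b := Real.sqrt s
  set c := Real.sqrt (2 * t + 2 * s)
  set d := Real.sqrt (2 * t - 2 * s)
  have hlow : a + b ≤ c := by
    refine abs_le_of_sq_le_sq' ?_ hc |>.2
    nlinarith [sq_nonneg (a - b)]
  refine ⟨?_, hlow, ?_⟩
  · refine abs_le_of_sq_le_sq' ?_ (by positivity) |>.2
    nlinarith [mul_nonneg hd ha.le, mul_nonneg hd hb,
      mul_nonneg (sub_nonneg.2 hab) (add_nonneg ha.le hb), mul_nonneg (sub_nonneg.2 hab) hb]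
  · rw [le_div_iff₀ (by positivity)]
    have h1 : (c - (a + b)) * a ≤ (a - b) ^ 2 := by
      nlinarith [mul_nonneg (sub_nonneg.2 hlow) (add_nonneg hc hb)]
    have h2 : a ^ 2 ≤ (a + b) ^ 2 := by nlinarith [mul_nonneg ha.le hb]
    calc (c - (a + b)) * a ^ 3 = (c - (a + b)) * a * a ^ 2 := by ring
      _ ≤ (a - b) ^ 2 * (a + b) ^ 2 := mul_le_mul h1 h2 (sq_nonneg _) (sq_nonneg _)
      _ = (t - s) ^ 2 := by rw [← ha2, ← hb2]; ring

/-- Lemma 2.1, (2.5) and (2.3): for `0 ≤ s < t`,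
`E|F(t) − F(s)|² = (1/√π)(√t + √s − √(2t+2s) + √(2t−2s))`, and
`|E|F(t) − F(s)|² − √(2(t−s)/π)| ≤ (t−s)²/t^{3/2}`. -/
theorem heat_increment_variance {Ω : Type*} [MeasurableSpace Ω]
    (P : Measure Ω) (F : ℝ → Ω → ℝ) (hF : IsHeatGaussian P F)
    (s t : ℝ) (hs : 0 ≤ s) (hst : s < t) :
    (∫ ω, (F t ω - F s ω) ^ 2 ∂P) =
      (Real.sqrt Real.pi)⁻¹ *
        (Real.sqrt t + Real.sqrt s - Real.sqrt (2 * t + 2 * s) +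
          Real.sqrt (2 * t - 2 * s)) ∧
    |(∫ ω, (F t ω - F s ω) ^ 2 ∂P) - Real.sqrt (2 * (t - s) / Real.pi)| ≤
      |t - s| ^ 2 / t ^ ((3 : ℝ) / 2) := by
  obtain ⟨hnonneg, hlow, hbound⟩ := sqrt_add_sqrt_bounds hs hst
  have hpi : 0 < (Real.sqrt Real.pi)⁻¹ := inv_pos.2 (Real.sqrt_pos.2 Real.pi_pos)
  have heq := hF.integral_sq_sub hs (hs.trans hst.le)
  rw [covK_increment hst, max_eq_left (mul_nonneg hpi.le (by linarith))] at heq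
  refine ⟨heq, ?_⟩
  have hpi1 : (Real.sqrt Real.pi)⁻¹ ≤ 1 :=
    inv_le_one_of_one_le₀ (Real.one_le_sqrt.2 (by linarith [Real.pi_gt_three]))
  have hmain : Real.sqrt (2 * (t - s) / Real.pi) =
      (Real.sqrt Real.pi)⁻¹ * Real.sqrt (2 * t - 2 * s) := by
    rw [Real.sqrt_div' _ Real.pi_pos.le, mul_sub, div_eq_inv_mul]
  rw [heq, hmain, sq_abs, ← mul_sub, abs_mul, abs_of_pos hpi, abs_of_nonpos (by linarith)]
  refine (mul_le_of_le_one_left (by linarith) hpi1).trans ?_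
  linarith
end
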